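/- Poincaré–Birkhoff–Witt expansion of the canonical form, type A_r: for every k∈ℕ^r, in the quotient U/I the identity Σ_J ω_J · f_{J(|k|)} f_{J(|k|−1)} ⋯ f_{J(1)} = Σ_p ω_p · F^p holds, where J ranges over all multi-indices of content k and p ranges over all maps p:{positive roots}→ℕ with Σ_β p_β·c(β) = k. -/

import Mathlib

open Finset
open scoped Classical

noncomputable section

/-- The set of variables `t⁽ⁱ⁾_a`, `1 ≤ i ≤ r`, `1 ≤ a ≤ k i`. -/
abbrev SVars (r : ℕ) (k : Fin r → ℕ) := (i : Fin r) × Fin (k i)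

/-- The field `K` of rational functions over `ℂ` in the variables `t⁽ⁱ⁾_a`. -/
abbrev RF (r : ℕ) (k : Fin r → ℕ) := FractionRing (MvPolynomial (SVars r k) ℂ)

/-- The variable `t⁽ⁱ⁾_a` as a rational function. -/
def Xv (r : ℕ) (k : Fin r → ℕ) (v : SVars r k) : RF r k :=
  algebraMap (MvPolynomial (SVars r k) ℂ) (RF r k) (MvPolynomial.X v)

/-- `posCount J u` is the number of `v < u` with the same color as `u`; under the
identification of the paper, `t_u = t^{(J(u))}_{posCount J u + 1}`. -/
def posCount {r n : ℕ} (J : Fin n → Fin r) (u : Fin n) : ℕ :=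
  (univ.filter fun v => J v = J u ∧ v < u).card

/-- The chain variable `t_u` (with `t_0 = 0`) as a rational function, after applying the
permutation `π ∈ G_k`. -/
def chainRF (r : ℕ) (k : Fin r → ℕ) {n : ℕ} (J : Fin n → Fin r)
    (π : ∀ i, Equiv.Perm (Fin (k i))) : ℕ → RF r k
  | 0 => 0
  | (u + 1) =>
    if h : u < n then
      if h2 : posCount J ⟨u, h⟩ < k (J ⟨u, h⟩) then
        Xv r k ⟨J ⟨u, h⟩, π (J ⟨u, h⟩) ⟨posCount J ⟨u, h⟩, h2⟩⟩
      else 0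
    else 0

/-- The canonical coefficient function
`ω_J = Σ_{π ∈ G_k} π·(∏_{u=1}^{n} 1/(t_u − t_{u−1}))` as a rational function. -/
def omegaRF (r : ℕ) (k : Fin r → ℕ) {n : ℕ} (J : Fin n → Fin r) : RF r k :=
  ∑ π : ∀ i, Equiv.Perm (Fin (k i)),
    ∏ u ∈ range n, (chainRF r k J π (u + 1) - chainRF r k J π u)⁻¹

/-- `J` is a multi-index of content `k`. -/
def IsContent (r : ℕ) {n : ℕ} (J : Fin n → Fin r) (k : Fin r → ℕ) : Prop :=
  ∀ i : Fin r, (univ.filter fun v => J v = i).card = k i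

/-- The free associative `K`-algebra `U` on the generators `f_1, …, f_r`. -/
abbrev FreeA (r : ℕ) (k : Fin r → ℕ) := FreeAlgebra (RF r k) (Fin r)

/-- The generator `f_{u+1}` (`0`-based index `u`). -/
def fgen (r : ℕ) (k : Fin r → ℕ) (u : ℕ) : FreeA r k :=
  if h : u < r then FreeAlgebra.ι (RF r k) ⟨u, h⟩ else 0

/-- The commutator `[a, b] = ab − ba`. -/
def lieBr {A : Type*} [Ring A] (a b : A) : A := a * b - b * a

/-- The iterated bracket `[f_{a_1}, [f_{a_2}, [… , f_{a_s}]…]]` (0-based indices). -/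
def listBracket (r : ℕ) (k : Fin r → ℕ) : List ℕ → FreeA r k
  | [] => 0
  | [a] => fgen r k a
  | a :: b :: l => lieBr (fgen r k a) (listBracket r k (b :: l))

/-- The monomial `f_{J(n)} f_{J(n−1)} ⋯ f_{J(1)}`. -/
def monJ (r : ℕ) (k : Fin r → ℕ) {n : ℕ} (J : Fin n → Fin r) : FreeA r k :=
  (List.ofFn fun u : Fin n => FreeAlgebra.ι (RF r k) (J u.rev)).prod

/-- The Serre elements of type `A_r` (0-based generator indices):
`[f_i, f_j]` for `|i−j| ≥ 2` and `[f_i, [f_i, f_j]]` for `|i−j| = 1`. -/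
def serreA (r : ℕ) (k : Fin r → ℕ) : Set (FreeA r k) :=
  {x | ∃ a b : Fin r, ((a : ℕ) + 2 ≤ (b : ℕ) ∨ (b : ℕ) + 2 ≤ (a : ℕ)) ∧
      x = lieBr (FreeAlgebra.ι (RF r k) a) (FreeAlgebra.ι (RF r k) b)} ∪
  {x | ∃ a b : Fin r, ((a : ℕ) + 1 = (b : ℕ) ∨ (b : ℕ) + 1 = (a : ℕ)) ∧
      x = lieBr (FreeAlgebra.ι (RF r k) a)
        (lieBr (FreeAlgebra.ι (RF r k) a) (FreeAlgebra.ι (RF r k) b))}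

/-- The positive roots of `A_r`: pairs `1 ≤ i < j ≤ r+1` (0-based: `0 ≤ i < j ≤ r`). -/
abbrev RootA (r : ℕ) := {q : Fin (r + 1) × Fin (r + 1) // q.1 < q.2}

/-- The content of the root `β_{ij} = α_i + … + α_{j−1}`: the indicator of `{i,…,j−1}`. -/
def contA (r : ℕ) (β : RootA r) : Fin r → ℕ :=
  fun u => if (β.1.1 : ℕ) ≤ (u : ℕ) ∧ (u : ℕ) < (β.1.2 : ℕ) then 1 else 0

/-- `F_{β_{ij}} = [f_{j−1}, [f_{j−2}, […, [f_{i+1}, f_i]…]]]` (1-based indices). -/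
def FrootA (r : ℕ) (k : Fin r → ℕ) (β : RootA r) : FreeA r k :=
  listBracket r k ((List.range' (β.1.1 : ℕ) ((β.1.2 : ℕ) - (β.1.1 : ℕ))).reverse)

/-- The linear order on the positive roots: `β_{ij} < β_{i'j'}` iff `i < i'`, or `i = i'`
and `j < j'`. -/
def beforeA (r : ℕ) (β β' : RootA r) : Prop :=
  (β.1.1 : ℕ) < (β'.1.1 : ℕ) ∨ ((β.1.1 : ℕ) = (β'.1.1 : ℕ) ∧ (β.1.2 : ℕ) < (β'.1.2 : ℕ))

/-- The offset of the color-`u` block of variables of the `c`-th copy of the factor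
`η_β` inside the star product defining `ω_p`. -/
def offA (r : ℕ) (p : RootA r → ℕ) (β : RootA r) (c : ℕ) (u : Fin r) : ℕ :=
  (∑ β' ∈ univ.filter (fun x => beforeA r x β), p β' * contA r β' u) + c * contA r β u

/-- The variable lookup for the `c`-th copy of the factor `η_β` in `ω_p`: the value
(after the global permutation `π ∈ G_k`) of the variable of 1-based color `u` and
lower index `a` of this factor. -/
def tvA (r : ℕ) (k : Fin r → ℕ) (p : RootA r → ℕ) (π : ∀ i, Equiv.Perm (Fin (k i)))
    (β : RootA r) (c : ℕ) (u a : ℕ) : RF r k :=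
  if h : u - 1 < r then
    if h2 : offA r p β c ⟨u - 1, h⟩ + (a - 1) < k ⟨u - 1, h⟩ then
      Xv r k ⟨⟨u - 1, h⟩, π ⟨u - 1, h⟩ ⟨offA r p β c ⟨u - 1, h⟩ + (a - 1), h2⟩⟩
    else 0
  else 0

/-- The function `η_{β_{ij}} = 1/(t⁽ⁱ⁾(t⁽ⁱ⁺¹⁾−t⁽ⁱ⁾)⋯(t⁽ʲ⁻¹⁾−t⁽ʲ⁻²⁾))` (1-based indices),
evaluated on the variables of the `c`-th copy of the factor `η_β` of `ω_p`. -/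
def etaA (r : ℕ) (k : Fin r → ℕ) (p : RootA r → ℕ) (π : ∀ i, Equiv.Perm (Fin (k i)))
    (β : RootA r) (c : ℕ) : RF r k :=
  (tvA r k p π β c ((β.1.1 : ℕ) + 1) 1)⁻¹ *
    ∏ u ∈ Finset.Icc ((β.1.1 : ℕ) + 2) (β.1.2 : ℕ),
      (tvA r k p π β c u 1 - tvA r k p π β c (u - 1) 1)⁻¹

/-- The coefficient `ω_p = (1/∏_β p_β!)·(star product of `p_β` copies of `η_β` over the
positive roots in increasing order)`, written out as a single symmetrization. -/
def omegaP (r : ℕ) (k : Fin r → ℕ) (p : RootA r → ℕ) : RF r k :=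
  ((∏ β : RootA r, (p β).factorial : ℕ) : RF r k)⁻¹ *
    ∑ π : ∀ i, Equiv.Perm (Fin (k i)),
      ∏ β : RootA r, ∏ c ∈ range (p β), etaA r k p π β c

/-- `p β` read off from the 0-based pair `(i, j)`. -/
def pAtA (r : ℕ) (p : RootA r → ℕ) (i j : ℕ) : ℕ :=
  if h : i < r + 1 ∧ j < r + 1 ∧ i < j then
    p ⟨(⟨i, h.1⟩, ⟨j, h.2.1⟩), by exact Fin.mk_lt_mk.mpr h.2.2⟩
  else 0

/-- The PBW monomial `F^p`: the product of the `F_β^{p_β}` over the positive roots in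
increasing order (smallest leftmost). -/
def FpowA (r : ℕ) (k : Fin r → ℕ) (p : RootA r → ℕ) : FreeA r k :=
  ((List.range (r + 1)).map fun i =>
    ((List.range' (i + 1) (r - i)).map fun j =>
      listBracket r k ((List.range' i (j - i)).reverse) ^ pAtA r p i j).prod).prod

section RootVectors

variable {A : Type*} [Ring A]

/-- The root vector `F_{ij} = [f_{j−1}, […, [f_{i+1}, f_i]…]]` of a sequence of generators
(`0` when `j ≤ i`). -/
def rootVec (f : ℕ → A) (i j : ℕ) : A :=
  Nat.rec 0 (fun n x => if n = i then f n else if i < n then lieBr (f n) x else 0) j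

/-- The Serre relations of type `A` for a sequence of generators. -/
structure SerreRel (f : ℕ → A) : Prop where
  far : ∀ a b, a + 2 ≤ b → Commute (f a) (f b)
  up : ∀ a, Commute (f a) (lieBr (f a) (f (a + 1)))
  down : ∀ a, Commute (f (a + 1)) (lieBr (f (a + 1)) (f a))

lemma rootVec_self_succ (f : ℕ → A) (i : ℕ) : rootVec f i (i + 1) = f i := by
  simp [rootVec]

lemma rootVec_succ (f : ℕ → A) {i j : ℕ} (h : i < j) :
    rootVec f i (j + 1) = lieBr (f j) (rootVec f i j) := by
  simp [rootVec, h, h.ne']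

lemma Commute.lieBr_right {a b c : A} (h : Commute a b) (h' : Commute a c) :
    Commute a (lieBr b c) :=
  (h.mul_right h').sub_right (h'.mul_right h)

lemma commute_rootVec_of_forall (f : ℕ → A) {i j : ℕ} (h : i < j) {a : A}
    (H : ∀ b, i ≤ b → b < j → Commute a (f b)) : Commute a (rootVec f i j) := by
  induction j, h using Nat.le_induction with
  | base => rw [rootVec_self_succ]; exact H i le_rfl (by simp)
  | succ j hj ih =>
    rw [rootVec_succ f hj]
    exact (H j (Nat.le_of_lt hj) (by simp)).lieBr_right
      (ih fun b hb hb' => H b hb (by omega))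

lemma lieBr_lieBr_right {a b c : A} (h : Commute a c) :
    lieBr a (lieBr b c) = lieBr (lieBr a b) c := by
  have h1 : a * c = c * a := h
  have h2 : b * (c * a) = b * (a * c) := by rw [h1]
  have h3 : a * c * b = c * a * b := by rw [h1]
  simp only [lieBr]
  linear_combination (norm := noncomm_ring) -h2 - h3

lemma commute_of_double_lieBr [IsAddTorsionFree A] {x y w : A} (hxw : Commute x w)
    (hx : Commute y (lieBr y x)) (hw : Commute y (lieBr y w)) :
    Commute y (lieBr x (lieBr y w)) := by
  have hx' : y * (y * x - x * y) - (y * x - x * y) * y = 0 := sub_eq_zero.2 hx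
  have hw' : y * (y * w - w * y) - (y * w - w * y) * y = 0 := sub_eq_zero.2 hw
  have hxw' : x * w - w * x = 0 := sub_eq_zero.2 hxw
  have key : 2 • (y * lieBr x (lieBr y w) - lieBr x (lieBr y w) * y) = 0 := by
    have e1 : (y * (y * x - x * y) - (y * x - x * y) * y) * w = 0 := by rw [hx', zero_mul]
    have e2 : w * (y * (y * x - x * y) - (y * x - x * y) * y) = 0 := by rw [hx', mul_zero]
    have e3 : (y * (y * w - w * y) - (y * w - w * y) * y) * x = 0 := by rw [hw', zero_mul]
    have e4 : x * (y * (y * w - w * y) - (y * w - w * y) * y) = 0 := by rw [hw', mul_zero]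
    have e5 : y * y * (x * w - w * x) = 0 := by rw [hxw', mul_zero]
    have e6 : y * (x * w - w * x) * y = 0 := by rw [hxw', mul_zero, zero_mul]
    have e7 : (x * w - w * x) * y * y = 0 := by rw [hxw', zero_mul, zero_mul]
    simp only [lieBr]
    linear_combination (norm := noncomm_ring) e4 - e3 - e1 + e2 + e5 - 2 * e6 + e7
  have := (smul_eq_zero_iff_right (two_ne_zero (α := ℕ))).1 key
  exact sub_eq_zero.1 this

variable {f : ℕ → A}

lemma SerreRel.commute_gen_rootVec_far (hf : SerreRel f) {i a j : ℕ} (h : a + 2 ≤ i)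
    (hj : i < j) : Commute (f a) (rootVec f i j) :=
  commute_rootVec_of_forall f hj fun b hb _ => hf.far a b (by omega)

lemma SerreRel.commute_last (hf : SerreRel f) {i a : ℕ} (h : i < a) :
    Commute (f a) (rootVec f i (a + 1)) := by
  rw [rootVec_succ f h]
  obtain ⟨a, rfl⟩ : ∃ b, a = b + 1 := ⟨a - 1, by omega⟩
  rcases (Nat.lt_succ_iff_lt_or_eq.1 h) with h | rfl
  · rw [rootVec_succ f h]
    have hc : Commute (f (a + 1)) (rootVec f i a) :=
      commute_rootVec_of_forall f h fun b _ hb' => (hf.far b (a + 1) (by omega)).symm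
    rw [lieBr_lieBr_right hc]
    exact (hf.down a).lieBr_right hc
  · rw [rootVec_self_succ]; exact hf.down i

/-- The generators `f_i, …, f_{j−1}` commute with `F_{ij}` when `j ≥ i + 2`. -/
lemma SerreRel.commute_gen_rootVec [IsAddTorsionFree A] (hf : SerreRel f) {i a j : ℕ}
    (hia : i ≤ a) (haj : a < j) (hj : i + 2 ≤ j) : Commute (f a) (rootVec f i j) := by
  induction j, hj using Nat.le_induction generalizing a with
  | base =>
    rcases (show a = i ∨ a = i + 1 by omega) with rfl | rfl
    · rw [rootVec_succ f (by omega), rootVec_self_succ]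
      have : lieBr (f (a + 1)) (f a) = -lieBr (f a) (f (a + 1)) := by simp [lieBr]
      rw [this]
      exact (hf.up a).neg_right
    · exact hf.commute_last (by omega)
  | succ j hj ih =>
    rcases (show a = j ∨ a + 1 = j ∨ a + 2 ≤ j by omega) with rfl | rfl | h
    · exact hf.commute_last (by omega)
    · rw [rootVec_succ f (by omega), rootVec_succ f (by omega)]
      refine commute_of_double_lieBr ?_ (hf.up a) ?_
      · exact commute_rootVec_of_forall f (by omega)
          fun b _ hb' => (hf.far b (a + 1) (by omega)).symm
      · rw [← rootVec_succ f (by omega)]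
        exact hf.commute_last (by omega)
    · rw [rootVec_succ f (by omega)]
      exact (hf.far a j h).lieBr_right (ih hia (by omega))

lemma SerreRel.commute_row [IsAddTorsionFree A] (hf : SerreRel f) {i j j' : ℕ} (h : i < j)
    (h' : i < j') : Commute (rootVec f i j) (rootVec f i j') := by
  wlog hjj : j < j' generalizing j j'
  · rcases (show j = j' ∨ j' < j by omega) with rfl | hlt
    · exact Commute.refl _
    · exact (this h' h hlt).symm
  exact (commute_rootVec_of_forall f h fun b hb hb' =>
    (hf.commute_gen_rootVec hb (by omega) (by omega)).symm).symm

lemma SerreRel.lieBr_rootVec_gen (hf : SerreRel f) {i j : ℕ} (h : i + 2 ≤ j) :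
    lieBr (rootVec f (i + 1) j) (f i) = rootVec f i j := by
  induction j, h using Nat.le_induction with
  | base => rw [rootVec_self_succ, rootVec_succ f (by omega), rootVec_self_succ]
  | succ j hj ih =>
    rw [rootVec_succ f (by omega), rootVec_succ f (by omega), ← ih, lieBr_lieBr_right]
    exact (hf.far i j hj).symm

lemma SerreRel.commute_adjacent_rows [IsAddTorsionFree A] (hf : SerreRel f) {i j j' : ℕ}
    (h : i + 2 ≤ j) (h' : i + 2 ≤ j') :
    Commute (rootVec f i j) (rootVec f (i + 1) j') := by
  have aux : ∀ {j j' : ℕ}, i + 2 ≤ j → i + 2 ≤ j' → j' ≤ j →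
      Commute (rootVec f i j) (rootVec f (i + 1) j') := fun h h' hle =>
    commute_rootVec_of_forall f (by omega) fun b hb hb' =>
      (hf.commute_gen_rootVec (by omega) (by omega) h).symm
  rcases le_total j' j with hle | hle
  · exact aux h h' hle
  · have h0 : lieBr (rootVec f (i + 1) j) (rootVec f i j') = 0 :=
      sub_eq_zero.2 (aux h' h hle).symm
    rw [← hf.lieBr_rootVec_gen h']  at h0
    have hc : Commute (rootVec f (i + 1) j) (rootVec f (i + 1) j') :=
      hf.commute_row (by omega) (by omega)
    have : lieBr (rootVec f (i + 1) j') (rootVec f i j) = 0 := by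
      rw [← hf.lieBr_rootVec_gen h, ← h0]
      have e : rootVec f (i + 1) j * rootVec f (i + 1) j' =
        rootVec f (i + 1) j' * rootVec f (i + 1) j := hc
      have e1 := congrArg (· * f i) e
      have e2 := congrArg (f i * ·) e
      simp only [lieBr] at *
      linear_combination (norm := noncomm_ring) e2 - e1
    exact (sub_eq_zero.1 this).symm

end RootVectors

section Monomials

lemma list_prod_pow_mul {A : Type*} [Ring A] (g h : ℕ → A) (c : A) (n : ℕ → ℕ) (l : List ℕ)
    (hl : l.Nodup) (hg : ∀ j ∈ l, g j * c = c * g j + h j)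
    (hc : ∀ j ∈ l, ∀ j' ∈ l, Commute (h j) (g j')) :
    (l.map fun j => g j ^ n j).prod * c = c * (l.map fun j => g j ^ n j).prod +
      ∑ j ∈ l.toFinset, n j • (h j * (l.map fun j' => g j' ^ (n j' - if j' = j then 1 else 0)).prod) := by
  have hpow : ∀ j ∈ l, ∀ m : ℕ, g j ^ m * c = c * g j ^ m + m • (h j * g j ^ (m - 1)) := by
    intro j hj m
    induction m with
    | zero => simp
    | succ m ih =>
      have hcom : g j ^ m * h j = h j * g j ^ m := ((hc j hj j hj).pow_right m).symm
      rw [pow_succ, mul_assoc, hg j hj, mul_add, ← mul_assoc, ih, hcom]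
      rcases m with _ | m
      · simp
      · simp only [add_tsub_cancel_right, pow_succ, add_mul, smul_mul_assoc, mul_assoc, succ_nsmul]
        abel
  induction l with
  | nil => simp
  | cons a l ih =>
    obtain ⟨ha, hl'⟩ := List.nodup_cons.1 hl
    have ih' := ih hl' (fun j hj => hg j (by simp [hj]))
      (fun j hj j' hj' => hc j (by simp [hj]) j' (by simp [hj']))
      (fun j hj => hpow j (by simp [hj]))
    rw [List.toFinset_cons, sum_insert (by simpa using ha), List.map_cons, List.prod_cons,
      mul_assoc, ih', mul_add, ← mul_assoc, hpow a (by simp), Finset.mul_sum, add_mul, add_assoc]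
    rw [mul_assoc]
    congr 2
    · rw [smul_mul_assoc, mul_assoc, List.map_cons, List.prod_cons, if_pos rfl]
      congr 4
      refine List.map_congr_left fun j hj => ?_
      rw [if_neg (ne_of_mem_of_not_mem hj ha), Nat.sub_zero]
    · refine sum_congr rfl fun j hj => ?_
      have hj : j ∈ l := by simpa using hj
      rw [mul_smul_comm, List.map_cons, List.prod_cons, if_neg (ne_of_mem_of_not_mem hj ha).symm,
        Nat.sub_zero, ← mul_assoc, ← mul_assoc]
      congr 2
      exact ((hc j (by simp [hj]) a (by simp)).pow_right _).symm

lemma mul_list_prod_pow {A : Type*} [Ring A] (g : ℕ → A) (n : ℕ → ℕ) (l : List ℕ)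
    (hl : l.Nodup) (j₀ : ℕ) (hj : j₀ ∈ l) (hc : ∀ j ∈ l, Commute (g j₀) (g j)) :
    g j₀ * (l.map fun j => g j ^ n j).prod =
      (l.map fun j => g j ^ (n j + if j = j₀ then 1 else 0)).prod := by
  induction l with
  | nil => simp at hj
  | cons a l ih =>
    obtain ⟨ha, hl'⟩ := List.nodup_cons.1 hl
    by_cases h : a = j₀
    · subst h
      rw [List.map_cons, List.prod_cons, List.map_cons, List.prod_cons, if_pos rfl, pow_succ',
        mul_assoc]
      congr 3
      refine List.map_congr_left fun j hj => ?_
      rw [if_neg (ne_of_mem_of_not_mem hj ha), Nat.add_zero]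
    · rw [List.map_cons, List.prod_cons, List.map_cons, List.prod_cons, if_neg h, ← mul_assoc,
        ((hc a (by simp)).pow_right (n a)).eq, mul_assoc,
        ih hl' (by simpa [Ne.symm h] using hj) fun j hj => hc j (by simp [hj])]
      simp

variable {A : Type*} [Ring A]

/-- The product of the powers of the root vectors `F_{ij}`, `j = i + 1, …, r`. -/
def rowProd (f : ℕ → A) (r i : ℕ) (n : ℕ → ℕ) : A :=
  ((List.range' (i + 1) (r - i)).map fun j => rootVec f i j ^ n j).prod

/-- The ordered monomial in the root vectors with exponents `m`. -/
def pbwMon (f : ℕ → A) (r : ℕ) (m : ℕ × ℕ → ℕ) : A :=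
  ((List.range (r + 1)).map fun i => rowProd f r i fun j => m (i, j)).prod

lemma pbwMon_split (f : ℕ → A) {r i : ℕ} (hi : i < r) (m : ℕ × ℕ → ℕ) :
    pbwMon f r m = ((List.range i).map fun i' => rowProd f r i' fun j => m (i', j)).prod *
      (rowProd f r i (fun j => m (i, j)) * (rowProd f r (i + 1) (fun j => m (i + 1, j)) *
        ((List.range' (i + 2) (r - i - 1)).map
          fun i' => rowProd f r i' fun j => m (i', j)).prod)) := by
  have : List.range (r + 1) = List.range i ++ (i :: (i + 1) :: List.range' (i + 2) (r - i - 1)) := by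
    have h2 : ∀ n, i :: (i + 1) :: List.range' (i + 2) n = List.range' i (n + 1 + 1) := fun n => by
      rw [List.range'_succ, List.range'_succ]
    rw [h2, List.range_eq_range', List.range_eq_range']
    have := List.range'_append (s := 0) (m := i) (n := r - i - 1 + 1 + 1) (step := 1)
    simp only [one_mul, zero_add] at this
    rw [this]
    congr 1
    omega
  rw [pbwMon, this]
  simp

variable {f : ℕ → A}

lemma SerreRel.commute_gen_rowProd (hf : SerreRel f) (r : ℕ) {i i' : ℕ} (h : i + 2 ≤ i')
    (n : ℕ → ℕ) : Commute (f i) (rowProd f r i' n) := by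
  refine Commute.list_prod_right _ _ fun x hx => ?_
  obtain ⟨j, hj, rfl⟩ := List.mem_map.1 hx
  rw [List.mem_range'_1] at hj
  exact (hf.commute_gen_rootVec_far h (by omega)).pow_right _

open MvPolynomial

variable {K : Type*} [Field K] [Algebra K A]

/-- The linear map sending a commutative monomial to the ordered monomial in the root
vectors. -/
def pbwMap (K : Type*) [Field K] [Algebra K A] (f : ℕ → A) (r : ℕ) :
    MvPolynomial (ℕ × ℕ) K →ₗ[K] A :=
  (basisMonomials (ℕ × ℕ) K).constr K fun m => pbwMon f r m

lemma pbwMap_monomial (f : ℕ → A) (r : ℕ) (m : ℕ × ℕ →₀ ℕ) (c : K) :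
    pbwMap K f r (monomial m c) = c • pbwMon f r m := by
  have : monomial m c = c • basisMonomials (ℕ × ℕ) K m := by
    simp [smul_monomial]
  rw [this, map_smul, pbwMap, Module.Basis.constr_basis]

/-- The derivation `Σ_j y_{ij} ∂/∂y_{i+1,j}`. -/
def rowDer (K : Type*) [Field K] (r i : ℕ) :
    Derivation K (MvPolynomial (ℕ × ℕ) K) (MvPolynomial (ℕ × ℕ) K) :=
  ∑ j ∈ Icc (i + 2) r, (X (i, j) : MvPolynomial (ℕ × ℕ) K) • pderiv (i + 1, j)

lemma rowDer_apply (r i : ℕ) (q : MvPolynomial (ℕ × ℕ) K) :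
    rowDer K r i q = ∑ j ∈ Icc (i + 2) r, X (i, j) * pderiv (i + 1, j) q := by
  have := congrFun (map_sum (Derivation.coeFnAddMonoidHom (R := K)
    (A := MvPolynomial (ℕ × ℕ) K) (M := MvPolynomial (ℕ × ℕ) K))
    (fun j => (X (i, j) : MvPolynomial (ℕ × ℕ) K) • pderiv (i + 1, j)) (Icc (i + 2) r)) q
  rw [Finset.sum_apply] at this
  exact this

variable [IsAddTorsionFree A]

lemma SerreRel.rootVec_mul_rowProd (hf : SerreRel f) {r i j₀ : ℕ} (h : i < j₀) (h' : j₀ ≤ r)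
    (n : ℕ → ℕ) : rootVec f i j₀ * rowProd f r i n =
      rowProd f r i fun j => n j + if j = j₀ then 1 else 0 :=
  mul_list_prod_pow _ n _ List.nodup_range' j₀ (by rw [List.mem_range'_1]; omega)
    fun j hj => hf.commute_row h (by rw [List.mem_range'_1] at hj; omega)

lemma SerreRel.rowProd_mul_gen (hf : SerreRel f) {r i : ℕ} (hi : i < r) (n : ℕ → ℕ) :
    rowProd f r (i + 1) n * f i = f i * rowProd f r (i + 1) n +
      ∑ j ∈ Icc (i + 2) r, n j • (rootVec f i j *
        rowProd f r (i + 1) fun j' => n j' - if j' = j then 1 else 0) := by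
  have : Icc (i + 2) r = (List.range' (i + 1 + 1) (r - (i + 1))).toFinset := by
    ext x
    rw [List.mem_toFinset, List.mem_range'_1, mem_Icc]
    omega
  rw [this]
  refine list_prod_pow_mul _ (rootVec f i) (f i) n _ List.nodup_range' ?_ ?_
  · intro j hj
    rw [List.mem_range'_1] at hj
    rw [← hf.lieBr_rootVec_gen (show i + 2 ≤ j by omega), lieBr, add_sub_cancel]
  · intro j hj j' hj'
    rw [List.mem_range'_1] at hj hj'
    exact hf.commute_adjacent_rows (by omega) (by omega)

/-- Right multiplication of an ordered monomial by a generator. -/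
lemma SerreRel.pbwMon_mul_gen (hf : SerreRel f) {r i : ℕ} (hi : i < r) (m : ℕ × ℕ →₀ ℕ) :
    pbwMon f r m * f i = pbwMon f r ⇑(m + Finsupp.single (i, i + 1) 1 : ℕ × ℕ →₀ ℕ) +
      ∑ j ∈ Icc (i + 2) r, m (i + 1, j) •
        pbwMon f r ⇑(m - Finsupp.single (i + 1, j) 1 + Finsupp.single (i, j) 1 : ℕ × ℕ →₀ ℕ) := by
  have htail : ∀ m' : ℕ × ℕ →₀ ℕ, (∀ i' j, i' ≠ i → i' ≠ i + 1 → m' (i', j) = m (i', j)) →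
      pbwMon f r m' = ((List.range i).map fun i' => rowProd f r i' fun j => m (i', j)).prod *
      (rowProd f r i (fun j => m' (i, j)) * (rowProd f r (i + 1) (fun j => m' (i + 1, j)) *
        ((List.range' (i + 2) (r - i - 1)).map
          fun i' => rowProd f r i' fun j => m (i', j)).prod)) := by
    intro m' hm'
    rw [pbwMon_split f hi]
    congr 2
    · refine List.map_congr_left fun i' hi' => ?_
      rw [List.mem_range] at hi'
      simp only [hm' i' _ (by omega) (by omega)]
    · congr 2
      refine List.map_congr_left fun i' hi' => ?_
      rw [List.mem_range'_1] at hi'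
      simp only [hm' i' _ (by omega) (by omega)]
  have hcomm : Commute (f i) ((List.range' (i + 2) (r - i - 1)).map
      fun i' => rowProd f r i' fun j => m (i', j)).prod := by
    refine Commute.list_prod_right _ _ fun x hx => ?_
    obtain ⟨i', hi', rfl⟩ := List.mem_map.1 hx
    rw [List.mem_range'_1] at hi'
    exact hf.commute_gen_rowProd r hi'.1 _
  have hrow : ∀ j₀, i < j₀ → j₀ ≤ r → ∀ n : ℕ → ℕ, rowProd f r i n * rootVec f i j₀ =
      rowProd f r i fun j => n j + if j = j₀ then 1 else 0 := by
    intro j₀ h h' n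
    rw [← hf.rootVec_mul_rowProd h h']
    refine (Commute.list_prod_right _ _ fun x hx => ?_ : Commute _ _).symm.eq
    obtain ⟨j, hj, rfl⟩ := List.mem_map.1 hx
    rw [List.mem_range'_1] at hj
    exact (hf.commute_row h (by omega)).pow_right _
  rw [pbwMon_split f hi, mul_assoc, mul_assoc, mul_assoc, hcomm.symm.eq,
    ← mul_assoc (rowProd f r (i + 1) _), hf.rowProd_mul_gen hi, add_mul, mul_add, mul_add]
  congr 1
  · rw [mul_assoc, ← mul_assoc (rowProd f r i _), ← rootVec_self_succ f i,
      hrow _ (by omega) (by omega), htail]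
    · congr 3
      · funext j
        simp [Finsupp.single_apply, eq_comm]
      · congr 1
        funext j
        simp
    · intro i' j h1 h2
      simp [Ne.symm h1]
  · rw [sum_mul, mul_sum, mul_sum]
    refine sum_congr rfl fun j hj => ?_
    rw [mem_Icc] at hj
    rw [smul_mul_assoc, mul_smul_comm, mul_smul_comm, mul_assoc, ← mul_assoc (rowProd f r i _),
      hrow _ (by omega) (by omega), htail]
    · congr 4
      · funext j'
        simp [Finsupp.single_apply, eq_comm]
      · congr 1
        funext j'
        simp [Finsupp.single_apply, eq_comm]
    · intro i' j h1 h2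
      simp [Ne.symm h1, Ne.symm h2]

lemma SerreRel.pbwMap_mul_gen (hf : SerreRel f) {r i : ℕ} (hi : i < r)
    (q : MvPolynomial (ℕ × ℕ) K) :
    pbwMap K f r q * f i = pbwMap K f r (X (i, i + 1) * q + rowDer K r i q) := by
  induction q using MvPolynomial.induction_on' with
  | monomial m c =>
    have hX : ∀ (i j : ℕ) (s : ℕ × ℕ →₀ ℕ) (a : K),
        X (i, j) * monomial s a = monomial (s + Finsupp.single (i, j) 1) a := by
      intro i j s a
      rw [X, monomial_mul, one_mul, add_comm]
    rw [rowDer_apply, map_add (pbwMap K f r), map_sum, hX, pbwMap_monomial, pbwMap_monomial, smul_mul_assoc,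
      hf.pbwMon_mul_gen hi, smul_add, smul_sum]
    congr 1
    refine sum_congr rfl fun j _ => ?_
    rw [pderiv_monomial, hX, pbwMap_monomial, mul_smul, Nat.cast_smul_eq_nsmul]
  | add p q hp hq =>
    rw [map_add, add_mul, hp, hq, ← map_add, map_add (rowDer K r i)]
    congr 1
    ring

end Monomials

section SetPartitions

variable {V : Type*} [DecidableEq V]

/-- The set partitions of a finite set `S`, as sets of nonempty blocks. -/
def setParts (S : Finset V) : Finset (Finset (Finset V)) :=
  S.powerset.powerset.filter fun P =>
    ∅ ∉ P ∧ (P : Set (Finset V)).PairwiseDisjoint id ∧ P.biUnion id = S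

lemma mem_setParts {S : Finset V} {P : Finset (Finset V)} :
    P ∈ setParts S ↔ ∅ ∉ P ∧ (P : Set (Finset V)).PairwiseDisjoint id ∧ P.biUnion id = S := by
  rw [setParts, mem_filter, and_iff_right_iff_imp]
  rintro ⟨-, -, rfl⟩
  rw [mem_powerset]
  intro B hB
  rw [mem_powerset]
  exact subset_biUnion_of_mem id hB

lemma setParts_empty : setParts (∅ : Finset V) = {∅} := by
  ext P
  rw [mem_setParts, mem_singleton]
  constructor
  · rintro ⟨h, -, h'⟩
    refine eq_empty_of_forall_notMem fun B hB => h ?_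
    have : B ⊆ ∅ := h' ▸ subset_biUnion_of_mem id hB
    rwa [← subset_empty.1 this]
  · rintro rfl
    simp

lemma erase_mem_setParts {S B : Finset V} {P : Finset (Finset V)} (hP : P ∈ setParts S)
    (hB : B ∈ P) : P.erase B ∈ setParts (S \ B) := by
  obtain ⟨h, hd, rfl⟩ := mem_setParts.1 hP
  refine mem_setParts.2 ⟨fun h' => h (mem_of_mem_erase h'),
    hd.subset (by simp), ?_⟩
  ext v
  simp only [mem_biUnion, mem_erase, id, mem_sdiff]
  constructor
  · rintro ⟨B', ⟨hne, hB'⟩, hv⟩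
    exact ⟨⟨B', hB', hv⟩, fun hv' =>
      (disjoint_left.1 (hd hB' hB hne) hv) hv'⟩
  · rintro ⟨⟨B', hB', hv⟩, hv'⟩
    exact ⟨B', ⟨fun h => hv' (h ▸ hv), hB'⟩, hv⟩

lemma insert_mem_setParts {S B : Finset V} {P : Finset (Finset V)} (hP : P ∈ setParts (S \ B))
    (hBS : B ⊆ S) (hB : B ≠ ∅) : B ∉ P ∧ insert B P ∈ setParts S := by
  obtain ⟨h, hd, hU⟩ := mem_setParts.1 hP
  have hdis : ∀ B' ∈ P, Disjoint B B' := fun B' hB' =>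
    disjoint_of_subset_right (hU ▸ subset_biUnion_of_mem id hB') disjoint_sdiff
  refine ⟨fun h' => hB (disjoint_self.1 (hdis B h')), mem_setParts.2 ⟨?_, ?_, ?_⟩⟩
  · simp [h, hB.symm]
  · rw [coe_insert]
    exact hd.insert fun B' hB' _ => hdis B' hB'
  · rw [biUnion_insert, hU, id, union_sdiff_of_subset hBS]

/-- Choosing a partition and one of its blocks is the same as choosing a nonempty subset and a
partition of its complement. -/
lemma sum_setParts_erase {M : Type*} [AddCommMonoid M] (S : Finset V)
    (h : Finset V → Finset (Finset V) → M) :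
    ∑ P ∈ setParts S, ∑ B ∈ P, h B (P.erase B) =
      ∑ B ∈ S.powerset.erase ∅, ∑ P ∈ setParts (S \ B), h B P := by
  rw [sum_sigma', sum_sigma']
  refine sum_bij' (fun x _ => ⟨x.2, x.1.erase x.2⟩) (fun x _ => ⟨insert x.1 x.2, x.1⟩)
    ?_ ?_ ?_ ?_ ?_
  · rintro ⟨P, B⟩ hx
    obtain ⟨hP, hB⟩ := mem_sigma.1 hx
    refine mem_sigma.2 ⟨?_, erase_mem_setParts hP hB⟩
    obtain ⟨h, -, rfl⟩ := mem_setParts.1 hP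
    exact mem_erase.2 ⟨fun h' => h (h' ▸ hB), mem_powerset.2 (subset_biUnion_of_mem id hB)⟩
  · rintro ⟨B, P⟩ hx
    obtain ⟨hB, hP⟩ := mem_sigma.1 hx
    rw [mem_erase, mem_powerset] at hB
    exact mem_sigma.2 ⟨(insert_mem_setParts hP hB.2 hB.1).2, mem_insert_self _ _⟩
  · rintro ⟨P, B⟩ hx
    simp [insert_erase (mem_sigma.1 hx).2]
  · rintro ⟨B, P⟩ hx
    obtain ⟨hB, hP⟩ := mem_sigma.1 hx
    rw [mem_erase, mem_powerset] at hB
    simp [erase_insert (insert_mem_setParts hP hB.2 hB.1).1]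
  · intros; rfl

/-- The sum over the set partitions of `S` of the products of the weights of the blocks. -/
def partSum {R : Type*} [CommSemiring R] (a : Finset V → R) (S : Finset V) : R :=
  ∑ P ∈ setParts S, ∏ B ∈ P, a B

lemma partSum_empty {R : Type*} [CommSemiring R] (a : Finset V → R) : partSum a ∅ = 1 := by
  simp [partSum, setParts_empty]

lemma derivation_partSum {K R : Type*} [CommRing K] [CommRing R] [Algebra K R]
    (D : Derivation K R R) (a : Finset V → R) (S : Finset V) :
    D (partSum a S) = ∑ B ∈ S.powerset.erase ∅, D (a B) * partSum a (S \ B) := by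
  simp only [partSum, mul_sum]
  rw [← sum_setParts_erase S fun B P => D (a B) * ∏ B' ∈ P, a B', map_sum]
  refine sum_congr rfl fun P hP => ?_
  clear hP
  induction P using Finset.induction_on with
  | empty => simp
  | insert B P hB ih =>
    rw [prod_insert hB, Derivation.leibniz, ih, sum_insert hB, erase_insert hB, add_comm,
      smul_eq_mul, smul_eq_mul, mul_comm (∏ B' ∈ P, a B'), mul_sum]
    congr 1
    refine sum_congr rfl fun B' hB' => ?_
    have hne : B ≠ B' := (ne_of_mem_of_not_mem hB' hB).symm
    rw [erase_insert_of_ne hne, prod_insert fun h => hB (mem_of_mem_erase h)]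
    ring

end SetPartitions

lemma prod_inv_sub_eq_sum {K ι : Type*} [Field K] [DecidableEq ι] (s : Finset ι)
    (hs : s.Nonempty) (c : ι → K) (hc : Set.InjOn c s) (z : K) (hz : ∀ b ∈ s, c b ≠ z) :
    ∏ b ∈ s, (c b - z)⁻¹ =
      ∑ b ∈ s, (c b - z)⁻¹ * ∏ b' ∈ s.erase b, (c b' - c b)⁻¹ := by
  have h1 := congrArg (Polynomial.eval z) (Lagrange.sum_basis hc hs)
  rw [Polynomial.eval_finsetSum, Polynomial.eval_one] at h1
  have hne : ∏ b ∈ s, (c b - z) ≠ 0 := prod_ne_zero_iff.2 fun b hb => sub_ne_zero.2 (hz b hb)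
  rw [prod_inv_distrib, inv_eq_iff_eq_inv, eq_comm, inv_eq_iff_eq_inv, ← mul_eq_one_iff_eq_inv₀ hne,
    sum_mul, ← h1]
  refine sum_congr rfl fun b hb => ?_
  rw [← mul_prod_erase s _ hb, Lagrange.basis, Polynomial.eval_prod]
  have h0 : c b - z ≠ 0 := sub_ne_zero.2 (hz b hb)
  rw [mul_mul_mul_comm, inv_mul_cancel₀ h0, one_mul, ← prod_mul_distrib]
  refine prod_congr rfl fun b' hb' => ?_
  rw [Lagrange.basisDivisor]
  simp only [Polynomial.eval_mul, Polynomial.eval_C, Polynomial.eval_sub, Polynomial.eval_X]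
  rw [← neg_sub (c b) (c b'), ← neg_sub z (c b'), inv_neg, neg_mul_neg]

section Blocks

open MvPolynomial

variable {V : Type*} (col : V → ℕ)

/-- `B` contains exactly one element of each of the colors `i, …, j − 1`, and nothing else. -/
def IsBlock (B : Finset V) (i j : ℕ) : Prop :=
  i < j ∧ Set.InjOn col B ∧ B.image col = Ico i j

/-- The smallest color of a block. -/
def blockLo (B : Finset V) : ℕ := sInf {u | ∃ v ∈ B, col v = u}

/-- The largest color of a block, plus one. -/
def blockHi (B : Finset V) : ℕ := blockLo col B + #B

/-- `B` has the content of a positive root. -/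
def IsRootBlock (B : Finset V) : Prop := IsBlock col B (blockLo col B) (blockHi col B)

variable {col}

lemma IsBlock.lo_eq {B : Finset V} {i j : ℕ} (h : IsBlock col B i j) : blockLo col B = i := by
  have : {u | ∃ v ∈ B, col v = u} = Set.Ico i j := by
    rw [← coe_Ico, ← h.2.2, coe_image]
    rfl
  rw [blockLo, this, csInf_Ico h.1]

lemma IsBlock.hi_eq {B : Finset V} {i j : ℕ} (h : IsBlock col B i j) : blockHi col B = j := by
  rw [blockHi, h.lo_eq, ← card_image_of_injOn h.2.1, h.2.2, Nat.card_Ico]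
  have := h.1
  omega

lemma IsBlock.isRootBlock {B : Finset V} {i j : ℕ} (h : IsBlock col B i j) :
    IsRootBlock col B := by
  rw [IsRootBlock, h.lo_eq, h.hi_eq]
  exact h

lemma IsBlock.exists_mem {B : Finset V} {i j : ℕ} (h : IsBlock col B i j) {u : ℕ} (hi : i ≤ u)
    (hj : u < j) : ∃ v ∈ B, col v = u := by
  have : u ∈ B.image col := by rw [h.2.2, mem_Ico]; exact ⟨hi, hj⟩
  simpa using this

lemma IsBlock.col_mem {B : Finset V} {i j : ℕ} (h : IsBlock col B i j) {v : V} (hv : v ∈ B) :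
    i ≤ col v ∧ col v < j := by
  rw [← mem_Ico, ← h.2.2]
  exact mem_image_of_mem _ hv

lemma isBlock_singleton (v : V) : IsBlock col {v} (col v) (col v + 1) :=
  ⟨by omega, by simp, by simp⟩

variable {K : Type*} [Field K] (col) (x : V → K)

/-- The coordinate of the element of color `u` of a block (`0` if there is none). -/
def blockVal (B : Finset V) (u : ℕ) : K := ∑ v ∈ B with col v = u, x v

/-- The part of the weight of a block with colors `i, …, j − 1` that does not involve the
base point. -/
def blockEta (B : Finset V) (i j : ℕ) : K :=
  ∏ u ∈ Ico (i + 1) j, (blockVal col x B u - blockVal col x B (u - 1))⁻¹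

/-- The weight of a block relative to the base point `z`; it vanishes unless the block has the
content of a positive root. -/
def blockWt (z : K) (B : Finset V) : K :=
  if IsRootBlock col B then
    (blockVal col x B (blockLo col B) - z)⁻¹ * blockEta col x B (blockLo col B) (blockHi col B)
  else 0

/-- The weight of a block times the variable recording its content. -/
def blockTerm (z : K) (B : Finset V) : MvPolynomial (ℕ × ℕ) K :=
  blockWt col x z B • X (blockLo col B, blockHi col B)

/-- The part of `blockTerm` that does not involve the base point. -/
def blockRes (B : Finset V) : MvPolynomial (ℕ × ℕ) K :=
  if IsRootBlock col B then
    blockEta col x B (blockLo col B) (blockHi col B) • X (blockLo col B, blockHi col B)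
  else 0

variable {col} {x}

lemma IsBlock.blockVal_eq {B : Finset V} {i j : ℕ} (h : IsBlock col B i j) {v : V} (hv : v ∈ B) :
    blockVal col x B (col v) = x v := by
  have : (B.filter fun w => col w = col v) = {v} := by
    ext w
    simp only [mem_filter, mem_singleton]
    exact ⟨fun hw => h.2.1 hw.1 hv hw.2, by rintro rfl; exact ⟨hv, rfl⟩⟩
  rw [blockVal, this, sum_singleton]

lemma blockTerm_eq (z : K) (B : Finset V) :
    blockTerm col x z B = (blockVal col x B (blockLo col B) - z)⁻¹ • blockRes col x B := by
  rw [blockTerm, blockWt, blockRes]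
  split_ifs
  · rw [mul_smul]
  · simp

lemma rowDer_X (r i p q : ℕ) (hq : q ≤ r) (hpq : p < q) :
    rowDer K r i (X (p, q)) = if p = i + 1 then X (i, q) else 0 := by
  rw [rowDer_apply]
  simp only [pderiv_X, Pi.single_apply, Prod.mk.injEq, mul_ite, mul_one, mul_zero]
  split_ifs with h
  · subst h
    simp only [true_and]
    rw [Finset.sum_ite_eq, if_pos]
    rw [mem_Icc]
    omega
  · simp [h]

variable [DecidableEq V]

lemma isBlock_insert_iff {B : Finset V} (hB : B.Nonempty) {v : V} (hv : v ∉ B) {j : ℕ} :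
    IsBlock col (insert v B) (col v) j ↔ IsBlock col B (col v + 1) j := by
  constructor
  · rintro ⟨h1, h2, h3⟩
    have himg : col v ∉ B.image col := by
      rw [mem_image]
      rintro ⟨w, hw, hwv⟩
      exact hv (h2 (by simp [hw]) (by simp) hwv ▸ hw)
    have h4 : B.image col = Ico (col v + 1) j := by
      rw [image_insert] at h3
      rw [← erase_insert himg, h3]
      ext u
      simp only [mem_erase, mem_Ico]
      omega
    refine ⟨?_, h2.mono (by simp), h4⟩
    obtain ⟨w, hw⟩ := hB
    have := mem_image_of_mem col hw
    rw [h4, mem_Ico] at this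
    omega
  · rintro ⟨h1, h2, h3⟩
    have himg : col v ∉ B.image col := by
      rw [h3, mem_Ico]
      omega
    refine ⟨by omega, ?_, ?_⟩
    · rw [coe_insert, Set.injOn_insert (by simpa using hv)]
      refine ⟨h2, ?_⟩
      rwa [← coe_image, mem_coe]
    · rw [image_insert, h3]
      ext u
      simp only [mem_insert, mem_Ico]
      omega

/-- The derivation `rowDer` prepends an element to a block. -/
lemma rowDer_blockTerm {r : ℕ} (hr : ∀ v, col v < r) {B : Finset V} (hB : B.Nonempty) {v : V}
    (hv : v ∉ B) : rowDer K r (col v) (blockTerm col x (x v) B) =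
      if col v = blockLo col (insert v B) then blockRes col x (insert v B) else 0 := by
  by_cases h : ∃ j, IsBlock col B (col v + 1) j
  · obtain ⟨j, hj⟩ := h
    have hj' := (isBlock_insert_iff hB hv).2 hj
    have hjr : j ≤ r := by
      have := hj.1
      obtain ⟨w, -, hw⟩ := hj.exists_mem (show col v + 1 ≤ j - 1 by omega) (by omega)
      have := hr w
      omega
    rw [hj'.lo_eq, if_pos rfl, blockRes, if_pos hj'.isRootBlock, hj'.lo_eq, hj'.hi_eq,
      blockTerm, blockWt, if_pos hj.isRootBlock, hj.lo_eq, hj.hi_eq, Derivation.map_smul,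
      rowDer_X r _ _ _ hjr hj.1, if_pos rfl]
    congr 1
    have hval : ∀ u, u ≠ col v → blockVal col x (insert v B) u = blockVal col x B u := by
      intro u hu
      rw [blockVal, filter_insert, if_neg (Ne.symm hu), blockVal]
    rw [blockEta, blockEta, prod_eq_prod_Ico_succ_bot hj.1, hval _ (by omega),
      Nat.add_sub_cancel, hj'.blockVal_eq (mem_insert_self _ _)]
    congr 1
    refine prod_congr rfl fun u hu => ?_
    rw [mem_Ico] at hu
    rw [hval _ (by omega), hval _ (by omega)]
  · have h1 : rowDer K r (col v) (blockTerm col x (x v) B) = 0 := by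
      rw [blockTerm, blockWt]
      split_ifs with hroot
      · have hle : blockHi col B ≤ r := by
          have := hroot.1
          obtain ⟨w, -, hw⟩ := hroot.exists_mem
            (show blockLo col B ≤ blockHi col B - 1 by omega) (by omega)
          have := hr w
          omega
        rw [Derivation.map_smul, rowDer_X r _ _ _ hle hroot.1, if_neg, smul_zero]
        intro he
        rw [IsRootBlock, he] at hroot
        exact h ⟨_, hroot⟩
      · simp
    rw [h1]
    split_ifs with hlo
    · rw [blockRes, if_neg]
      intro hroot
      rw [IsRootBlock, ← hlo, isBlock_insert_iff hB hv] at hroot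
      exact h ⟨_, hroot⟩
    · rfl

lemma prod_blockTerm {S : Finset V} (hS : S.Nonempty) (hx : Set.InjOn x S) {z : K}
    (hz : ∀ v ∈ S, x v ≠ z) {P : Finset (Finset V)} (hP : P ∈ setParts S) :
    ∏ B ∈ P, blockTerm col x z B = ∑ B ∈ P, (blockVal col x B (blockLo col B) - z)⁻¹ •
      (blockRes col x B *
        ∏ B' ∈ P.erase B, blockTerm col x (blockVal col x B (blockLo col B)) B') := by
  obtain ⟨-, hd, hU⟩ := mem_setParts.1 hP
  by_cases hroot : ∀ B ∈ P, IsRootBlock col B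
  · have hval : ∀ B ∈ P, ∃ v ∈ B, blockVal col x B (blockLo col B) = x v := by
      intro B hB
      obtain ⟨v, hv, hlo⟩ := (hroot B hB).exists_mem le_rfl (hroot B hB).1
      exact ⟨v, hv, by rw [← hlo, (hroot B hB).blockVal_eq hv]⟩
    have hsub : ∀ B ∈ P, B ⊆ S := fun B hB => hU ▸ subset_biUnion_of_mem id hB
    have hPne : P.Nonempty := by
      rw [nonempty_iff_ne_empty]
      rintro rfl
      simp [← hU] at hS
    have hinj : Set.InjOn (fun B => blockVal col x B (blockLo col B)) P := by
      intro B hB B' hB' heq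
      obtain ⟨v, hv, hv'⟩ := hval B hB
      obtain ⟨w, hw, hw'⟩ := hval B' hB'
      have hvw : v = w := hx (hsub B hB hv) (hsub B' hB' hw) (by rw [← hv', ← hw']; exact heq)
      by_contra hne
      exact disjoint_left.1 (hd hB hB' hne) hv (hvw ▸ hw)
    have hne : ∀ B ∈ P, blockVal col x B (blockLo col B) ≠ z := by
      intro B hB
      obtain ⟨v, hv, hv'⟩ := hval B hB
      rw [hv']
      exact hz v (hsub B hB hv)
    simp only [blockTerm_eq]
    simp only [prod_smul]
    rw [prod_inv_sub_eq_sum P hPne _ hinj z hne, sum_smul]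
    refine sum_congr rfl fun B hB => ?_
    rw [mul_smul_comm, mul_prod_erase P _ hB, mul_smul]
  · push Not at hroot
    obtain ⟨B, hB, hB'⟩ := hroot
    have h0 : blockRes col x B = 0 := by rw [blockRes, if_neg hB']
    rw [prod_eq_zero hB (by rw [blockTerm_eq, h0, smul_zero]), eq_comm]
    refine sum_eq_zero fun B₁ hB₁ => ?_
    by_cases h : B = B₁
    · rw [← h, h0, zero_mul, smul_zero]
    · rw [prod_eq_zero (mem_erase.2 ⟨h, hB⟩) (by rw [blockTerm_eq, h0, smul_zero]), mul_zero,
        smul_zero]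

/-- The recursion satisfied by the partition sum. -/
lemma partSum_blockTerm {r : ℕ} (hr : ∀ v, col v < r) {S : Finset V} (hS : S.Nonempty)
    (hx : Set.InjOn x S) {z : K} (hz : ∀ v ∈ S, x v ≠ z) :
    partSum (blockTerm col x z) S = ∑ v ∈ S, (x v - z)⁻¹ •
      (X (col v, col v + 1) * partSum (blockTerm col x (x v)) (S.erase v) +
        rowDer K r (col v) (partSum (blockTerm col x (x v)) (S.erase v))) := by
  rw [partSum, sum_congr rfl fun P hP => prod_blockTerm hS hx hz hP,
    sum_setParts_erase S fun B P => (blockVal col x B (blockLo col B) - z)⁻¹ •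
      (blockRes col x B * ∏ B' ∈ P, blockTerm col x (blockVal col x B (blockLo col B)) B')]
  simp only [← smul_sum, ← mul_sum]
  have h1 : ∀ B ∈ S.powerset.erase ∅, (blockVal col x B (blockLo col B) - z)⁻¹ •
      (blockRes col x B * ∑ P ∈ setParts (S \ B),
        ∏ B' ∈ P, blockTerm col x (blockVal col x B (blockLo col B)) B') =
      ∑ v ∈ B, (x v - z)⁻¹ • ((if col v = blockLo col B then blockRes col x B else 0) *
        partSum (blockTerm col x (x v)) (S \ B)) := by
    intro B _
    by_cases hroot : IsRootBlock col B
    · obtain ⟨v, hv, hlo⟩ := hroot.exists_mem le_rfl hroot.1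
      rw [sum_eq_single v, if_pos hlo, ← hlo, hroot.blockVal_eq hv]
      · rfl
      · intro w hw hwv
        rw [if_neg, zero_mul, smul_zero]
        rw [← hlo]
        exact fun h => hwv (hroot.2.1 hw hv h)
      · exact fun h => (h hv).elim
    · have h0 : blockRes col x B = 0 := by rw [blockRes, if_neg hroot]
      simp [h0]
  rw [sum_congr rfl h1, sum_comm' (t' := S)
    (s' := fun v => (S.erase v).powerset.image (insert v))]
  · refine sum_congr rfl fun v hv => ?_
    rw [sum_image, ← smul_sum]
    · refine congrArg _ ?_
      rw [derivation_partSum, ← add_sum_erase _ _ (empty_mem_powerset (S.erase v))]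
      refine congrArg₂ _ ?_ ?_
      · rw [insert_empty_eq, (isBlock_singleton v).lo_eq, if_pos rfl, blockRes,
          if_pos (isBlock_singleton v).isRootBlock, (isBlock_singleton v).lo_eq,
          (isBlock_singleton v).hi_eq, sdiff_singleton_eq_erase, blockEta, Ico_self, prod_empty,
          one_smul]
      · refine sum_congr rfl fun B hB => ?_
        rw [mem_erase, mem_powerset] at hB
        rw [rowDer_blockTerm hr (nonempty_iff_ne_empty.2 hB.1) fun h => by simpa using hB.2 h,
          sdiff_insert, erase_sdiff_comm]
    · intro B hB B' hB' h
      simp only [coe_powerset, Set.mem_preimage, Set.mem_powerset_iff, coe_subset] at hB hB'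
      rw [← erase_insert (fun h => by simpa using hB h : v ∉ B), h,
        erase_insert (fun h => by simpa using hB' h : v ∉ B')]
  · intro B v
    rw [mem_erase, mem_powerset, mem_image]
    constructor
    · rintro ⟨⟨-, hBS⟩, hv⟩
      exact ⟨⟨B.erase v, mem_powerset.2 (erase_subset_erase v hBS), insert_erase hv⟩, hBS hv⟩
    · rintro ⟨⟨B', hB', rfl⟩, hv⟩
      rw [mem_powerset] at hB'
      exact ⟨⟨insert_ne_empty _ _, insert_subset hv (hB'.trans (erase_subset _ _))⟩,
        mem_insert_self _ _⟩

end Blocks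

section Chains

variable {V K A : Type*} [DecidableEq V] [Field K] [Ring A] [Algebra K A]

/-- The sum over the orderings `v_1, …, v_n` of the `n`-element set `S` of the products
`∏ 1/(x_{v_u} − x_{v_{u−1}}) · e_{v_n} ⋯ e_{v_1}`, with `x_{v_0} = z`. -/
def chainSum (x : V → K) (e : V → A) : ℕ → K → Finset V → A
  | 0, _, _ => 1
  | n + 1, z, S => ∑ v ∈ S, (x v - z)⁻¹ • (chainSum x e n (x v) (S.erase v) * e v)

/-- The expansion of the sum over orderings in ordered monomials of root vectors. -/
lemma SerreRel.chainSum_eq [IsAddTorsionFree A] {f : ℕ → A} (hf : SerreRel f) {r : ℕ}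
    {col : V → ℕ} (hr : ∀ v, col v < r) {x : V → K} (hx : Function.Injective x) (n : ℕ) (z : K)
    (S : Finset V) (hS : #S = n) (hz : ∀ v ∈ S, x v ≠ z) :
    chainSum x (fun v => f (col v)) n z S = pbwMap K f r (partSum (blockTerm col x z) S) := by
  induction n generalizing z S with
  | zero =>
    rw [card_eq_zero] at hS
    subst hS
    rw [partSum_empty, chainSum, MvPolynomial.one_def, pbwMap_monomial, one_smul]
    simp [pbwMon, rowProd]
  | succ n ih =>
    rw [chainSum, partSum_blockTerm hr (card_pos.1 (by omega)) hx.injOn hz, map_sum]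
    refine sum_congr rfl fun v hv => ?_
    rw [map_smul, ← hf.pbwMap_mul_gen (hr v), ih]
    · rw [card_erase_of_mem hv, hS, Nat.add_sub_cancel]
    · exact fun w hw h => ne_of_mem_erase hw (hx h)

/-- The coordinate of the `u`-th point of a sequence of elements, started at the base point
`z`. -/
def chainPt (x : V → K) (z : K) {n : ℕ} (σ : Fin n → V) : ℕ → K
  | 0 => z
  | u + 1 => if h : u < n then x (σ ⟨u, h⟩) else 0

lemma chainSum_eq_sum [Fintype V] (x : V → K) (e : V → A) (n : ℕ) (z : K) (S : Finset V) :
    chainSum x e n z S =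
      ∑ σ : Fin n → V with Function.Injective σ ∧ ∀ u, σ u ∈ S,
        (∏ u ∈ range n, (chainPt x z σ (u + 1) - chainPt x z σ u)⁻¹) •
          (List.ofFn fun u => e (σ u.rev)).prod := by
  induction n generalizing z S with
  | zero =>
    rw [sum_filter, Fintype.sum_unique, if_pos ⟨fun a => a.elim0, fun a => a.elim0⟩]
    simp [chainSum]
  | succ n ih =>
    simp only [chainSum, ih, sum_mul, smul_sum]
    rw [sum_sigma']
    refine sum_bij' (fun y _ => Fin.cons y.1 y.2) (fun σ _ => ⟨σ 0, Fin.tail σ⟩) ?_ ?_ ?_ ?_ ?_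
    · rintro ⟨v, σ⟩ h
      simp only [mem_sigma, mem_filter, mem_univ, true_and, mem_erase] at h ⊢
      refine ⟨Fin.cons_injective_iff.2 ⟨?_, h.2.1⟩, Fin.cases h.1 fun u => (h.2.2 u).2⟩
      rintro ⟨u, hu⟩
      exact (h.2.2 u).1 hu
    · intro σ h
      simp only [mem_sigma, mem_filter, mem_univ, true_and, mem_erase] at h ⊢
      exact ⟨h.2 0, h.1.comp (Fin.succ_injective n),
        fun u => ⟨fun h' => Fin.succ_ne_zero u (h.1 h'), h.2 _⟩⟩
    · rintro ⟨v, σ⟩ h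
      simp
    · intro σ h
      simp
    · rintro ⟨v, σ⟩ h
      have hpt : ∀ u, chainPt x z (Fin.cons v σ : Fin (n + 1) → V) (u + 1) =
          chainPt x (x v) σ u := by
        intro u
        rcases u with _ | u
        · simp [chainPt]
        · simp only [chainPt, Nat.add_lt_add_iff_right]
          rfl
      simp only [prod_range_succ', hpt]
      rw [smul_mul_assoc, smul_smul, mul_comm, List.ofFn_succ', List.prod_concat]
      simp [chainPt, Fin.rev_castSucc]

end Chains

section ColoredBijections

variable {r : ℕ} {k : Fin r → ℕ} {Y : Type*} [Fintype Y] [DecidableEq Y]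

/-- The permutations in `G_k` act simply transitively on the color-preserving bijections onto the
variables. -/
lemma sum_perm_eq_sum_bijective {M : Type*} [AddCommMonoid M] {q : Y → SVars r k}
    (hq : Function.Bijective q) (H : (Y → SVars r k) → M) :
    ∑ π : ∀ i, Equiv.Perm (Fin (k i)), H (fun y => ⟨(q y).1, π (q y).1 (q y).2⟩) =
      ∑ σ : Y → SVars r k with Function.Bijective σ ∧ ∀ y, (σ y).1 = (q y).1, H σ := by
  have hmap : ∀ π : ∀ i, Equiv.Perm (Fin (k i)),
      (fun y => (⟨(q y).1, π (q y).1 (q y).2⟩ : SVars r k)) =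
        (Sigma.map id fun i => (π i : Fin (k i) → Fin (k i))) ∘ q := fun π => rfl
  refine sum_bij (fun π _ y => ⟨(q y).1, π (q y).1 (q y).2⟩) ?_ ?_ ?_ ?_
  · intro π _
    rw [mem_filter]
    refine ⟨mem_univ _, ?_, fun y => rfl⟩
    rw [hmap]
    refine Function.Bijective.comp ?_ hq
    exact (Finite.injective_iff_bijective).1
      (Function.injective_id.sigma_map fun i => (π i).injective)
  · intro π _ π' _ h
    rw [hmap, hmap] at h
    have h' := hq.2.injective_comp_right h
    funext i
    refine Equiv.ext fun a => ?_
    have := congrFun h' ⟨i, a⟩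
    simpa [Sigma.map] using this
  · intro σ hσ
    obtain ⟨hb, hc⟩ := (mem_filter.1 hσ).2
    let e := Equiv.ofBijective q hq
    have h1 : ∀ i a, ∃ b, σ (e.symm ⟨i, a⟩) = ⟨i, b⟩ := by
      intro i a
      have h2 := hc (e.symm ⟨i, a⟩)
      have h3 : q (e.symm ⟨i, a⟩) = ⟨i, a⟩ := e.apply_symm_apply _
      rw [h3] at h2
      rcases hs : σ (e.symm ⟨i, a⟩) with ⟨i', b⟩
      rw [hs] at h2
      obtain rfl : i' = i := h2
      exact ⟨b, rfl⟩
    choose g hg using h1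
    have hinj : ∀ i, Function.Injective (g i) := by
      intro i a b hab
      have : σ (e.symm ⟨i, a⟩) = σ (e.symm ⟨i, b⟩) := by rw [hg, hg, hab]
      have := e.symm.injective (hb.1 this)
      simpa using this
    refine ⟨fun i => Equiv.ofBijective (g i) (Finite.injective_iff_bijective.1 (hinj i)),
      mem_univ _, ?_⟩
    funext y
    have : e.symm ⟨(q y).1, (q y).2⟩ = y := e.symm_apply_apply y
    rw [Equiv.ofBijective_apply, ← hg, this]
  · intros; rfl

end ColoredBijections

section MultiIndices

variable {r : ℕ} {k : Fin r → ℕ}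

lemma posCount_lt {n : ℕ} {J : Fin n → Fin r} (hJ : IsContent r J k) (u : Fin n) :
    posCount J u < k (J u) := by
  rw [← hJ (J u), posCount]
  refine card_lt_card ⟨fun v hv => ?_, fun h => ?_⟩
  · exact mem_filter.2 ⟨mem_univ _, (mem_filter.1 hv).2.1⟩
  · exact lt_irrefl u (mem_filter.1 (h (mem_filter.2 ⟨mem_univ u, rfl⟩))).2.2

lemma posCount_strictMono {n : ℕ} {J : Fin n → Fin r} {u v : Fin n} (h : J u = J v)
    (huv : u < v) : posCount J u < posCount J v := by
  refine card_lt_card ⟨fun w hw => ?_, fun h' => ?_⟩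
  · obtain ⟨-, h1, h2⟩ := mem_filter.1 hw
    exact mem_filter.2 ⟨mem_univ _, h1.trans h, h2.trans huv⟩
  · exact lt_irrefl u (mem_filter.1 (h' (mem_filter.2 ⟨mem_univ u, h, huv⟩))).2.2

/-- The identification of the positions of a multi-index of content `k` with the variables. -/
def posVar {n : ℕ} {J : Fin n → Fin r} (hJ : IsContent r J k) (u : Fin n) : SVars r k :=
  ⟨J u, ⟨posCount J u, posCount_lt hJ u⟩⟩

lemma posVar_injective {n : ℕ} {J : Fin n → Fin r} (hJ : IsContent r J k) :
    Function.Injective (posVar hJ) := by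
  intro u v h
  rw [posVar, posVar, Sigma.mk.injEq] at h
  obtain ⟨h1, h2⟩ := h
  have h3 : posCount J u = posCount J v := (Fin.heq_ext_iff (by rw [h1])).1 h2
  rcases lt_trichotomy u v with h | h | h
  · exact absurd h3 (posCount_strictMono h1 h).ne
  · exact h
  · exact absurd h3 (posCount_strictMono h1.symm h).ne'

lemma posVar_bijective {J : Fin (∑ i, k i) → Fin r} (hJ : IsContent r J k) :
    Function.Bijective (posVar hJ) :=
  (Fintype.bijective_iff_injective_and_card _).2
    ⟨posVar_injective hJ, by simp [Fintype.card_sigma]⟩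

lemma chainRF_eq_chainPt {n : ℕ} {J : Fin n → Fin r} (hJ : IsContent r J k)
    (π : ∀ i, Equiv.Perm (Fin (k i))) (u : ℕ) :
    chainRF r k J π u =
      chainPt (Xv r k) 0 (fun y => ⟨(posVar hJ y).1, π (posVar hJ y).1 (posVar hJ y).2⟩) u := by
  rcases u with _ | u
  · rfl
  · rw [chainRF, chainPt]
    split_ifs with h h'
    · rfl
    · exact absurd (posCount_lt hJ _) h'
    · rfl

lemma isContent_of_bijective {n : ℕ} {σ : Fin n → SVars r k} (hσ : Function.Bijective σ) :
    IsContent r (fun u => (σ u).1) k := by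
  intro i
  rw [← Fintype.card_subtype]
  let e := Equiv.ofBijective σ hσ
  change Fintype.card {u // (e u).1 = i} = k i
  rw [Fintype.card_congr (e.subtypeEquiv (q := fun v => v.1 = i) fun _ => Iff.rfl),
    Fintype.card_congr (Equiv.sigmaSubtype i), Fintype.card_fin]

/-- The canonical form as a sum over the orderings of all variables. -/
lemma sum_omegaRF_mul_monJ :
    ∑ J ∈ univ.filter (fun J : Fin (∑ i, k i) → Fin r => IsContent r J k),
        algebraMap (RF r k) (FreeA r k) (omegaRF r k J) * monJ r k J =
      chainSum (Xv r k) (fun v => fgen r k v.1) (∑ i, k i) 0 univ := by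
  have hJ : ∀ J ∈ univ.filter (fun J : Fin (∑ i, k i) → Fin r => IsContent r J k),
      algebraMap (RF r k) (FreeA r k) (omegaRF r k J) * monJ r k J =
        ∑ σ : Fin (∑ i, k i) → SVars r k with Function.Bijective σ ∧ ∀ u, (σ u).1 = J u,
          (∏ u ∈ range (∑ i, k i),
            (chainPt (Xv r k) 0 σ (u + 1) - chainPt (Xv r k) 0 σ u)⁻¹) •
          (List.ofFn fun u => fgen r k (σ u.rev).1).prod := by
    intro J hJ
    have hJ := (mem_filter.1 hJ).2
    rw [← Algebra.smul_def, omegaRF, sum_smul]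
    simp only [chainRF_eq_chainPt hJ]
    have hq := sum_perm_eq_sum_bijective (posVar_bijective hJ) fun σ =>
      (∏ u ∈ range (∑ i, k i), (chainPt (Xv r k) 0 σ (u + 1) - chainPt (Xv r k) 0 σ u)⁻¹) •
        monJ r k J
    refine hq.trans (sum_congr (by ext; simp only [mem_filter]; rfl) fun σ hσ => ?_)
    rw [monJ]
    congr 3
    funext u
    rw [(mem_filter.1 hσ).2.2]
    simp [fgen]
  rw [sum_congr rfl hJ, chainSum_eq_sum]
  rw [sum_comm' (t' := univ.filter fun σ : Fin (∑ i, k i) → SVars r k =>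
    Function.Injective σ ∧ ∀ u, σ u ∈ univ) (s' := fun σ => {fun u => (σ u).1})]
  · simp
  · intro J σ
    have hb : Function.Injective σ ↔ Function.Bijective σ := by
      rw [Fintype.bijective_iff_injective_and_card]
      simp [Fintype.card_sigma]
    simp only [mem_filter, mem_univ, true_and, mem_singleton, implies_true, and_true, hb]
    constructor
    · rintro ⟨-, h, h'⟩
      exact ⟨funext fun u => (h' u).symm, h⟩
    · rintro ⟨rfl, h⟩
      exact ⟨isContent_of_bijective h, h, fun u => rfl⟩

lemma map_chainSum {V K A B : Type*} [DecidableEq V] [Field K] [Ring A] [Algebra K A] [Ring B]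
    [Algebra K B] (φ : A →ₐ[K] B) (x : V → K) (e : V → A) (n : ℕ) (z : K) (S : Finset V) :
    φ (chainSum x e n z S) = chainSum x (fun v => φ (e v)) n z S := by
  induction n generalizing z S with
  | zero => simp [chainSum]
  | succ n ih => simp [chainSum, ih]

end MultiIndices

section Slots

variable {r : ℕ} {k : Fin r → ℕ} {p : RootA r → ℕ}

/-- The variables of the factors of `ω_p`: the color-`u` variable of the `c`-th copy of
`η_β`. -/
abbrev Slot (r : ℕ) (p : RootA r → ℕ) :=
  {y : ((β : RootA r) × Fin (p β)) × Fin r //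
    (y.1.1.1.1 : ℕ) ≤ (y.2 : ℕ) ∧ (y.2 : ℕ) < (y.1.1.1.2 : ℕ)}

lemma contA_eq_one {β : RootA r} {u : Fin r} (h : (β.1.1 : ℕ) ≤ (u : ℕ) ∧ (u : ℕ) < (β.1.2 : ℕ)) :
    contA r β u = 1 := if_pos h

lemma not_beforeA_self (β : RootA r) : ¬ beforeA r β β := by
  simp [beforeA]

lemma beforeA_trans {β β' β'' : RootA r} (h : beforeA r β β') (h' : beforeA r β' β'') :
    beforeA r β β'' := by
  unfold beforeA at *
  omega

lemma beforeA_trichotomy (β β' : RootA r) : beforeA r β β' ∨ β = β' ∨ beforeA r β' β := by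
  by_cases h : β = β'
  · exact Or.inr (Or.inl h)
  · have : ¬ ((β.1.1 : ℕ) = β'.1.1 ∧ (β.1.2 : ℕ) = β'.1.2) := fun h' =>
      h (Subtype.ext (Prod.ext (Fin.ext h'.1) (Fin.ext h'.2)))
    unfold beforeA
    omega

lemma offA_succ_le {β : RootA r} {c : ℕ} (hc : c < p β) (u : Fin r) :
    offA r p β c u + contA r β u ≤
      ∑ β' ∈ insert β (univ.filter fun x => beforeA r x β), p β' * contA r β' u := by
  rw [sum_insert (by simp [not_beforeA_self]), offA]
  have := Nat.mul_le_mul_right (contA r β u) (Nat.succ_le_of_lt hc)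
  rw [Nat.succ_mul] at this
  omega

lemma offA_lt (hp : ∀ u : Fin r, ∑ β : RootA r, p β * contA r β u = k u) {β : RootA r} {c : ℕ}
    (hc : c < p β) {u : Fin r} (hu : (β.1.1 : ℕ) ≤ (u : ℕ) ∧ (u : ℕ) < (β.1.2 : ℕ)) :
    offA r p β c u < k u := by
  have h := offA_succ_le hc u
  rw [contA_eq_one hu, ← Nat.lt_iff_add_one_le] at h
  refine h.trans_le ?_
  rw [← hp u]
  exact sum_le_sum_of_subset (subset_univ _)

lemma offA_lt_of_beforeA {β β' : RootA r} (h : beforeA r β β') {c : ℕ} (c' : ℕ)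
    (hc : c < p β) {u : Fin r} (hu : (β.1.1 : ℕ) ≤ (u : ℕ) ∧ (u : ℕ) < (β.1.2 : ℕ)) :
    offA r p β c u < offA r p β' c' u := by
  have h' := offA_succ_le hc u
  rw [contA_eq_one hu, ← Nat.lt_iff_add_one_le] at h'
  refine h'.trans_le ((sum_le_sum_of_subset ?_).trans (Nat.le_add_right _ _))
  intro x hx
  rw [mem_filter]
  refine ⟨mem_univ _, ?_⟩
  rcases mem_insert.1 hx with rfl | hx
  · exact h
  · exact beforeA_trans (mem_filter.1 hx).2 h

/-- The variable of `ω_p` in a given slot, before symmetrization. -/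
def slotVar (hp : ∀ u : Fin r, ∑ β : RootA r, p β * contA r β u = k u) (y : Slot r p) :
    SVars r k :=
  ⟨y.1.2, ⟨offA r p y.1.1.1 y.1.1.2 y.1.2, offA_lt hp y.1.1.2.2 y.2⟩⟩

lemma slotVar_injective (hp : ∀ u : Fin r, ∑ β : RootA r, p β * contA r β u = k u) :
    Function.Injective (slotVar hp) := by
  rintro ⟨⟨⟨β, c⟩, u⟩, hu⟩ ⟨⟨⟨β', c'⟩, u'⟩, hu'⟩ h
  rw [slotVar, slotVar, Sigma.mk.injEq] at h
  obtain ⟨h1, h2⟩ := h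
  obtain rfl : u = u' := h1
  have h3 : offA r p β c u = offA r p β' c' u := congrArg Fin.val (eq_of_heq h2)
  rcases beforeA_trichotomy β β' with h | rfl | h
  · exact absurd h3 (offA_lt_of_beforeA h c' c.2 hu).ne
  · have : contA r β u = 1 := contA_eq_one hu
    have : c = c' := Fin.ext (by simpa [offA, this] using h3)
    rw [this]
  · exact absurd h3 (offA_lt_of_beforeA h c c'.2 hu').ne'

lemma card_slot (hp : ∀ u : Fin r, ∑ β : RootA r, p β * contA r β u = k u) :
    Fintype.card (Slot r p) = Fintype.card (SVars r k) := by
  have h : ∀ x : ((β : RootA r) × Fin (p β)) × Fin r,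
      (if (x.1.1.1.1 : ℕ) ≤ (x.2 : ℕ) ∧ (x.2 : ℕ) < (x.1.1.1.2 : ℕ) then 1 else 0) =
        contA r x.1.1 x.2 := fun x => rfl
  rw [Fintype.card_subtype, card_filter, Fintype.card_sigma]
  simp only [h, Fintype.card_fin]
  rw [Fintype.sum_prod_type_right]
  refine sum_congr rfl fun u _ => ?_
  rw [← hp u, Fintype.sum_sigma]
  simp

lemma slotVar_bijective (hp : ∀ u : Fin r, ∑ β : RootA r, p β * contA r β u = k u) :
    Function.Bijective (slotVar hp) :=
  (Fintype.bijective_iff_injective_and_card _).2 ⟨slotVar_injective hp, card_slot hp⟩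

/-- The set of variables assigned to one factor of `ω_p`. -/
def slotBlock (σ : Slot r p → SVars r k) (x : (β : RootA r) × Fin (p β)) : Finset (SVars r k) :=
  (univ.filter fun y : Slot r p => y.1.1 = x).image σ

lemma mem_slotBlock {σ : Slot r p → SVars r k} {x : (β : RootA r) × Fin (p β)} {v : SVars r k} :
    v ∈ slotBlock σ x ↔ ∃ y : Slot r p, y.1.1 = x ∧ σ y = v := by
  simp only [slotBlock, mem_image, mem_filter, mem_univ, true_and]

lemma isBlock_slotBlock {σ : Slot r p → SVars r k} (hσ : ∀ y, (σ y).1 = y.1.2)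
    (x : (β : RootA r) × Fin (p β)) :
    IsBlock (fun v : SVars r k => (v.1 : ℕ)) (slotBlock σ x) x.1.1.1 x.1.1.2 := by
  refine ⟨x.1.2, ?_, ?_⟩
  · intro v hv w hw h
    obtain ⟨y, hy, rfl⟩ := mem_slotBlock.1 hv
    obtain ⟨y', hy', rfl⟩ := mem_slotBlock.1 hw
    simp only [hσ] at h
    rw [Subtype.ext (Prod.ext (hy.trans hy'.symm) (Fin.ext h))]
  · ext u
    simp only [mem_image, mem_slotBlock, mem_Ico]
    constructor
    · rintro ⟨v, ⟨y, rfl, rfl⟩, rfl⟩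
      rw [hσ]
      exact y.2
    · rintro h
      have hu : u < r := by have := x.1.1.2.2; omega
      exact ⟨σ ⟨(x, ⟨u, hu⟩), h⟩, ⟨_, rfl, rfl⟩, by rw [hσ]⟩

lemma slotBlock_injective {σ : Slot r p → SVars r k} (h : Function.Injective σ)
    (hσ : ∀ y, (σ y).1 = y.1.2) : Function.Injective (slotBlock σ) := by
  intro x x' hx
  obtain ⟨v, hv, -⟩ := (isBlock_slotBlock hσ x).exists_mem le_rfl x.1.2
  obtain ⟨y, hy, rfl⟩ := mem_slotBlock.1 hv
  rw [hx] at hv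
  obtain ⟨y', hy', h'⟩ := mem_slotBlock.1 hv
  rw [← hy, ← hy', h h']

/-- The factors of `ω_p` are the weights of the blocks of variables. -/
lemma etaA_eq_blockWt (hp : ∀ u : Fin r, ∑ β : RootA r, p β * contA r β u = k u)
    (π : ∀ i, Equiv.Perm (Fin (k i))) (x : (β : RootA r) × Fin (p β)) :
    etaA r k p π x.1 x.2 = blockWt (fun v : SVars r k => (v.1 : ℕ)) (Xv r k) 0
      (slotBlock (fun y => ⟨(slotVar hp y).1, π (slotVar hp y).1 (slotVar hp y).2⟩) x) := by
  set σ : Slot r p → SVars r k :=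
    fun y => ⟨(slotVar hp y).1, π (slotVar hp y).1 (slotVar hp y).2⟩ with hσ
  have hb := isBlock_slotBlock (σ := σ) (fun y => rfl) x
  have htv : ∀ u : ℕ, (x.1.1.1 : ℕ) ≤ u → u < (x.1.1.2 : ℕ) →
      tvA r k p π x.1 x.2 (u + 1) 1 =
        blockVal (fun v : SVars r k => (v.1 : ℕ)) (Xv r k) (slotBlock σ x) u := by
    intro u h h'
    have hu : u < r := by have := x.1.1.2.2; omega
    have hv : σ ⟨(x, ⟨u, hu⟩), h, h'⟩ ∈ slotBlock σ x := mem_slotBlock.2 ⟨_, rfl, rfl⟩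
    refine Eq.trans ?_ (hb.blockVal_eq hv).symm
    have hlt : offA r p x.1 x.2 ⟨u, hu⟩ < k ⟨u, hu⟩ := offA_lt hp x.2.2 ⟨h, h'⟩
    simp only [tvA, Nat.add_sub_cancel, Nat.sub_self, Nat.add_zero, dif_pos hu, dif_pos hlt]
    rfl
  rw [blockWt, if_pos hb.isRootBlock, hb.lo_eq, hb.hi_eq, etaA, blockEta,
    htv _ le_rfl x.1.2, sub_zero]
  congr 1
  have hx : (x.1.1.1 : ℕ) < x.1.1.2 := x.1.2
  refine prod_bij' (fun u _ => u - 1) (fun u _ => u + 1) ?_ ?_ ?_ ?_ ?_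
  · intro u hu
    simp only [mem_Icc, mem_Ico] at hu ⊢
    omega
  · intro u hu
    simp only [mem_Icc, mem_Ico] at hu ⊢
    omega
  · intro u hu
    simp only [mem_Icc] at hu
    omega
  · intro u hu
    simp
  · intro u hu
    simp only [mem_Icc] at hu
    obtain ⟨w, rfl⟩ : ∃ w, u = w + 2 := ⟨u - 2, by omega⟩
    simp only [Nat.add_sub_cancel, show w + 2 - 1 = w + 1 by omega]
    rw [htv (w + 1) (by omega) (by omega), htv w (by omega) (by omega)]

end Slots

section TypedPartitions

variable {r : ℕ} {k : Fin r → ℕ} {p : RootA r → ℕ}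

/-- The color of a variable. -/
abbrev colV (r : ℕ) (k : Fin r → ℕ) (v : SVars r k) : ℕ := v.1

/-- The blocks of `P` whose content is the positive root `β`. -/
def rootBlocks (P : Finset (Finset (SVars r k))) (β : RootA r) : Finset (Finset (SVars r k)) :=
  P.filter fun B => IsBlock (colV r k) B β.1.1 β.1.2

/-- The number of blocks of `P` of each content. -/
def typeOf (P : Finset (Finset (SVars r k))) (β : RootA r) : ℕ := #(rootBlocks P β)

/-- The partitions of the set of all variables into blocks whose contents are positive roots. -/
def rootParts (r : ℕ) (k : Fin r → ℕ) : Finset (Finset (Finset (SVars r k))) :=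
  (setParts univ).filter fun P => ∀ B ∈ P, IsRootBlock (colV r k) B

lemma IsRootBlock.exists_root {B : Finset (SVars r k)} (h : IsRootBlock (colV r k) B) :
    ∃ β : RootA r, IsBlock (colV r k) B β.1.1 β.1.2 := by
  have hlt := h.1
  obtain ⟨v, -, hv⟩ := h.exists_mem (u := blockHi (colV r k) B - 1) (by omega) (by omega)
  have hv' : (v.1 : ℕ) < r := v.1.2
  have hv'' : (v.1 : ℕ) = blockHi (colV r k) B - 1 := hv
  exact ⟨⟨(⟨blockLo (colV r k) B, by omega⟩, ⟨blockHi (colV r k) B, by omega⟩),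
    Fin.mk_lt_mk.2 hlt⟩, h⟩

lemma IsBlock.root_unique {B : Finset (SVars r k)} {β β' : RootA r}
    (h : IsBlock (colV r k) B β.1.1 β.1.2) (h' : IsBlock (colV r k) B β'.1.1 β'.1.2) :
    β = β' :=
  Subtype.ext (Prod.ext (Fin.ext (h.lo_eq.symm.trans h'.lo_eq))
    (Fin.ext (h.hi_eq.symm.trans h'.hi_eq)))

/-- Grouping the blocks of a partition by their contents. -/
lemma prod_eq_prod_rootBlocks {M : Type*} [CommMonoid M] {P : Finset (Finset (SVars r k))}
    (hP : P ∈ rootParts r k) (g : Finset (SVars r k) → M) :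
    ∏ B ∈ P, g B = ∏ β : RootA r, ∏ B ∈ rootBlocks P β, g B := by
  rw [← prod_biUnion]
  · refine prod_congr ?_ fun _ _ => rfl
    ext B
    simp only [mem_biUnion, mem_univ, true_and, rootBlocks, mem_filter]
    constructor
    · intro hB
      obtain ⟨β, hβ⟩ := IsRootBlock.exists_root ((mem_filter.1 hP).2 B hB)
      exact ⟨β, hB, hβ⟩
    · rintro ⟨β, hB, -⟩
      exact hB
  · intro β _ β' _ hne
    refine disjoint_left.2 fun B hB hB' => hne ?_
    exact IsBlock.root_unique (mem_filter.1 hB).2 (mem_filter.1 hB').2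

lemma exists_mem_of_mem_rootParts {P : Finset (Finset (SVars r k))} (hP : P ∈ rootParts r k)
    (v : SVars r k) : ∃ B ∈ P, v ∈ B := by
  have : v ∈ P.biUnion id := by
    rw [(mem_setParts.1 (mem_filter.1 hP).1).2.2]
    exact mem_univ v
  simpa using this

lemma sum_typeOf_mul_contA {P : Finset (Finset (SVars r k))} (hP : P ∈ rootParts r k)
    (u : Fin r) : ∑ β : RootA r, typeOf P β * contA r β u = k u := by
  obtain ⟨-, hd, hU⟩ := mem_setParts.1 (mem_filter.1 hP).1
  have h1 : #((univ : Finset (SVars r k)).filter fun v => v.1 = u) = k u := by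
    rw [← Fintype.card_subtype, Fintype.card_congr (Equiv.sigmaSubtype u), Fintype.card_fin]
  rw [← h1, ← hU, filter_biUnion, card_biUnion
    fun B hB B' hB' hne => disjoint_filter_filter (hd hB hB' hne)]
  have h2 := prod_eq_prod_rootBlocks (M := Multiplicative ℕ) hP
    fun B => Multiplicative.ofAdd #((id B).filter fun v => v.1 = u)
  have h3 : ∑ B ∈ P, #((id B).filter fun v => v.1 = u) =
    ∑ β : RootA r, ∑ B ∈ rootBlocks P β, #((id B).filter fun v => v.1 = u) := h2
  rw [h3]
  refine sum_congr rfl fun β _ => ?_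
  rw [typeOf, ← smul_eq_mul, ← sum_const]
  refine sum_congr rfl fun B hB => ?_
  have hB := (mem_filter.1 hB).2
  rw [contA]
  symm
  split_ifs with hu
  · obtain ⟨v, hv, hvu⟩ := hB.exists_mem hu.1 hu.2
    rw [card_eq_one]
    refine ⟨v, ?_⟩
    ext w
    rw [mem_filter, mem_singleton]
    constructor
    · rintro ⟨hw, rfl⟩
      exact hB.2.1 hw hv hvu.symm
    · rintro rfl
      exact ⟨hv, Fin.ext hvu⟩
  · rw [card_eq_zero, filter_eq_empty_iff]
    rintro v hv rfl
    exact hu (hB.col_mem hv)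

/-- The color-preserving bijections from the slots onto the variables. -/
def slotBij (r : ℕ) (k : Fin r → ℕ) (p : RootA r → ℕ) : Finset (Slot r p → SVars r k) :=
  univ.filter fun σ => Function.Bijective σ ∧ ∀ y, (σ y).1 = y.1.2

lemma image_slotBlock_mem {σ : Slot r p → SVars r k} (hσ : σ ∈ slotBij r k p) :
    univ.image (slotBlock σ) ∈ rootParts r k := by
  obtain ⟨hb, hc⟩ := (mem_filter.1 hσ).2
  refine mem_filter.2 ⟨mem_setParts.2 ⟨?_, ?_, ?_⟩, ?_⟩
  · intro h
    obtain ⟨x, -, hx⟩ := mem_image.1 h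
    obtain ⟨v, hv, -⟩ := (isBlock_slotBlock hc x).exists_mem le_rfl x.1.2
    rw [hx] at hv
    exact notMem_empty v hv
  · intro B hB B' hB' hne
    obtain ⟨x, -, rfl⟩ := mem_image.1 (mem_coe.1 hB)
    obtain ⟨x', -, rfl⟩ := mem_image.1 (mem_coe.1 hB')
    refine disjoint_left.2 fun v hv hv' => hne ?_
    obtain ⟨y, rfl, rfl⟩ := mem_slotBlock.1 hv
    obtain ⟨y', rfl, h⟩ := mem_slotBlock.1 hv'
    rw [hb.1 h]
  · refine eq_univ_of_forall fun v => ?_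
    obtain ⟨y, rfl⟩ := hb.2 v
    exact mem_biUnion.2 ⟨_, mem_image_of_mem _ (mem_univ y.1.1), mem_slotBlock.2 ⟨y, rfl, rfl⟩⟩
  · intro B hB
    obtain ⟨x, -, rfl⟩ := mem_image.1 hB
    exact (isBlock_slotBlock hc x).isRootBlock

lemma slotBlock_mem_rootBlocks {σ : Slot r p → SVars r k} (hc : ∀ y, (σ y).1 = y.1.2)
    (β : RootA r) (c : Fin (p β)) :
    slotBlock σ ⟨β, c⟩ ∈ rootBlocks (univ.image (slotBlock σ)) β :=
  mem_filter.2 ⟨mem_image_of_mem _ (mem_univ _), isBlock_slotBlock hc ⟨β, c⟩⟩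

lemma slotBlock_bijective {σ : Slot r p → SVars r k} (hσ : σ ∈ slotBij r k p) (β : RootA r) :
    Function.Bijective fun c : Fin (p β) =>
      (⟨slotBlock σ ⟨β, c⟩, slotBlock_mem_rootBlocks (mem_filter.1 hσ).2.2 β c⟩ :
        rootBlocks (univ.image (slotBlock σ)) β) := by
  obtain ⟨hb, hc⟩ := (mem_filter.1 hσ).2
  constructor
  · intro c c' h
    have := slotBlock_injective hb.1 hc (congrArg Subtype.val h)
    simpa using this
  · rintro ⟨B, hB⟩
    obtain ⟨h1, h2⟩ := mem_filter.1 hB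
    obtain ⟨⟨β', c⟩, -, rfl⟩ := mem_image.1 h1
    obtain rfl : β' = β := IsBlock.root_unique (isBlock_slotBlock hc ⟨β', c⟩) h2
    exact ⟨c, rfl⟩

lemma typeOf_image_slotBlock {σ : Slot r p → SVars r k} (hσ : σ ∈ slotBij r k p) :
    typeOf (univ.image (slotBlock σ)) = p := by
  funext β
  have := Fintype.card_congr (Equiv.ofBijective _ (slotBlock_bijective hσ β))
  rw [Fintype.card_fin, Fintype.card_coe] at this
  exact this.symm

section Fiber

variable {P : Finset (Finset (SVars r k))} (g : ∀ β, Fin (p β) ≃ rootBlocks P β)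

lemma exists_slot_elem (y : Slot r p) :
    ∃ v ∈ (g y.1.1.1 y.1.1.2).1, colV r k v = (y.1.2 : ℕ) :=
  (mem_filter.1 (g y.1.1.1 y.1.1.2).2).2.exists_mem y.2.1 y.2.2

/-- The bijection from the slots onto the variables that assigns the copies of `η_β` to the
blocks of content `β` according to `g`. -/
def slotElem (y : Slot r p) : SVars r k := (exists_slot_elem g y).choose

lemma slotElem_mem (y : Slot r p) : slotElem g y ∈ (g y.1.1.1 y.1.1.2).1 :=
  (exists_slot_elem g y).choose_spec.1

lemma slotElem_color (y : Slot r p) : (slotElem g y).1 = y.1.2 :=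
  Fin.ext (exists_slot_elem g y).choose_spec.2

lemma eq_slotElem {y : Slot r p} {v : SVars r k} (hv : v ∈ (g y.1.1.1 y.1.1.2).1)
    (hc : v.1 = y.1.2) : v = slotElem g y :=
  (mem_filter.1 (g y.1.1.1 y.1.1.2).2).2.2.1 hv (slotElem_mem g y)
    (congrArg Fin.val (hc.trans (slotElem_color g y).symm))

lemma slotBlock_slotElem (x : (β : RootA r) × Fin (p β)) :
    slotBlock (slotElem g) x = (g x.1 x.2).1 := by
  ext v
  rw [mem_slotBlock]
  constructor
  · rintro ⟨y, rfl, rfl⟩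
    exact slotElem_mem g y
  · intro hv
    have hc := (mem_filter.1 (g x.1 x.2).2).2.col_mem hv
    exact ⟨⟨(x, v.1), hc⟩, rfl, (eq_slotElem g (y := ⟨(x, v.1), hc⟩) hv rfl).symm⟩

lemma image_slotBlock_slotElem (hP : P ∈ rootParts r k) :
    univ.image (slotBlock (slotElem g)) = P := by
  ext B
  simp only [mem_image, mem_univ, true_and, slotBlock_slotElem]
  constructor
  · rintro ⟨x, rfl⟩
    exact (mem_filter.1 (g x.1 x.2).2).1
  · intro hB
    obtain ⟨β, hβ⟩ := IsRootBlock.exists_root ((mem_filter.1 hP).2 B hB)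
    exact ⟨⟨β, (g β).symm ⟨B, mem_filter.2 ⟨hB, hβ⟩⟩⟩, by simp⟩

lemma slotElem_mem_slotBij (hp : ∀ u : Fin r, ∑ β : RootA r, p β * contA r β u = k u)
    (hP : P ∈ rootParts r k) : slotElem g ∈ slotBij r k p := by
  refine mem_filter.2 ⟨mem_univ _, ?_, slotElem_color g⟩
  refine (Fintype.bijective_iff_surjective_and_card _).2 ⟨fun v => ?_, card_slot hp⟩
  obtain ⟨B, hB, hv⟩ := exists_mem_of_mem_rootParts hP v
  rw [← image_slotBlock_slotElem g hP] at hB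
  obtain ⟨x, -, rfl⟩ := mem_image.1 hB
  obtain ⟨y, -, hy⟩ := mem_slotBlock.1 hv
  exact ⟨y, hy⟩

end Fiber

/-- The labeling of the blocks of content `β` given by a color-preserving bijection. -/
def slotEquiv {σ : Slot r p → SVars r k} (hσ : σ ∈ slotBij r k p) (β : RootA r) :
    Fin (p β) ≃ rootBlocks (univ.image (slotBlock σ)) β :=
  Equiv.ofBijective _ (slotBlock_bijective hσ β)

lemma slotElem_slotEquiv {σ : Slot r p → SVars r k} (hσ : σ ∈ slotBij r k p) :
    slotElem (slotEquiv hσ) = σ := by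
  funext y
  have h : σ y ∈ (slotEquiv hσ y.1.1.1 y.1.1.2).1 := mem_slotBlock.2 ⟨y, rfl, rfl⟩
  exact (eq_slotElem (slotEquiv hσ) h ((mem_filter.1 hσ).2.2 y)).symm

/-- The number of color-preserving bijections inducing a given partition. -/
lemma card_slotBij_fiber (hp : ∀ u : Fin r, ∑ β : RootA r, p β * contA r β u = k u)
    {P : Finset (Finset (SVars r k))} (hP : P ∈ rootParts r k) (hPp : typeOf P = p) :
    #((slotBij r k p).filter fun σ => univ.image (slotBlock σ) = P) =
      ∏ β : RootA r, (p β).factorial := by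
  have hcard : Fintype.card (∀ β, Fin (p β) ≃ rootBlocks P β) =
      ∏ β : RootA r, (p β).factorial := by
    rw [Fintype.card_pi]
    refine prod_congr rfl fun β _ => ?_
    have h : Fintype.card (Fin (p β)) = Fintype.card (rootBlocks P β) := by
      rw [Fintype.card_fin, Fintype.card_coe, ← congrFun hPp β, typeOf]
    rw [Fintype.card_equiv (Fintype.equivOfCardEq h), Fintype.card_fin]
  rw [← hcard, ← card_univ]
  symm
  refine card_bij (fun g _ => slotElem g) ?_ ?_ ?_
  · intro g _
    exact mem_filter.2 ⟨slotElem_mem_slotBij g hp hP, image_slotBlock_slotElem g hP⟩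
  · intro g _ g' _ h
    funext β
    refine Equiv.ext fun c => Subtype.ext ?_
    rw [← slotBlock_slotElem g ⟨β, c⟩, ← slotBlock_slotElem g' ⟨β, c⟩, h]
  · intro σ h
    obtain ⟨hσ, rfl⟩ := mem_filter.1 h
    exact ⟨slotEquiv hσ, mem_univ _, slotElem_slotEquiv hσ⟩

/-- The coefficient `ω_p` as a sum over the partitions of type `p`. -/
lemma omegaP_eq_sum (hp : ∀ u : Fin r, ∑ β : RootA r, p β * contA r β u = k u) :
    omegaP r k p = ∑ P ∈ rootParts r k with typeOf P = p,
      ∏ B ∈ P, blockWt (colV r k) (Xv r k) 0 B := by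
  have h1 : ∀ π : ∀ i, Equiv.Perm (Fin (k i)),
      ∏ β : RootA r, ∏ c ∈ range (p β), etaA r k p π β c =
        ∏ x : (β : RootA r) × Fin (p β), blockWt (colV r k) (Xv r k) 0
          (slotBlock (fun y => ⟨(slotVar hp y).1, π (slotVar hp y).1 (slotVar hp y).2⟩) x) := by
    intro π
    rw [Fintype.prod_sigma]
    refine prod_congr rfl fun β _ => ?_
    rw [prod_range]
    exact prod_congr rfl fun c _ => etaA_eq_blockWt hp π ⟨β, c⟩
  have h2 : ∑ π : ∀ i, Equiv.Perm (Fin (k i)), ∏ β : RootA r, ∏ c ∈ range (p β),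
      etaA r k p π β c = ∑ σ ∈ slotBij r k p, ∏ B ∈ univ.image (slotBlock σ),
        blockWt (colV r k) (Xv r k) 0 B := by
    rw [sum_congr rfl fun π _ => h1 π]
    refine (sum_perm_eq_sum_bijective (slotVar_bijective hp) fun σ =>
      ∏ x : (β : RootA r) × Fin (p β), blockWt (colV r k) (Xv r k) 0 (slotBlock σ x)).trans ?_
    refine sum_congr (by ext; simp only [slotBij, mem_filter]; rfl) fun σ hσ => ?_
    obtain ⟨hb, hc⟩ := (mem_filter.1 hσ).2
    rw [prod_image (slotBlock_injective hb.1 hc).injOn]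
  have h3 : ∀ σ ∈ slotBij r k p, univ.image (slotBlock σ) ∈
      (rootParts r k).filter fun P => typeOf P = p := fun σ hσ =>
    mem_filter.2 ⟨image_slotBlock_mem hσ, typeOf_image_slotBlock hσ⟩
  have h4 : ((∏ β : RootA r, (p β).factorial : ℕ) : RF r k) ≠ 0 :=
    Nat.cast_ne_zero.2 (prod_ne_zero_iff.2 fun β _ => Nat.factorial_ne_zero _)
  rw [omegaP, h2, ← sum_fiberwise_of_maps_to h3, mul_sum]
  refine sum_congr rfl fun P hP => ?_
  obtain ⟨hP, hPp⟩ := mem_filter.1 hP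
  rw [sum_congr rfl fun σ hσ => by rw [(mem_filter.1 hσ).2], sum_const,
    card_slotBij_fiber hp hP hPp, nsmul_eq_mul, inv_mul_cancel_left₀ h4]

end TypedPartitions

section Expansion

variable {r : ℕ} {k : Fin r → ℕ}

lemma listBracket_cons (a : ℕ) {l : List ℕ} (hl : l ≠ []) :
    listBracket r k (a :: l) = lieBr (fgen r k a) (listBracket r k l) := by
  rcases l with _ | ⟨b, l⟩
  · exact absurd rfl hl
  · rfl

lemma listBracket_reverse_range' {i j : ℕ} (h : i < j) :
    listBracket r k (List.range' i (j - i)).reverse = rootVec (fgen r k) i j := by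
  induction j, h using Nat.le_induction with
  | base => simp [rootVec_self_succ, listBracket]
  | succ j hj ih =>
    have hij : i < j := hj
    rw [rootVec_succ _ hij, ← ih, Nat.succ_sub hij.le, Nat.succ_eq_add_one, List.range'_1_concat,
      List.reverse_append, Nat.add_sub_cancel' hij.le]
    refine listBracket_cons j ?_
    simp
    omega

lemma pbwMon_congr {A : Type*} [Ring A] (f : ℕ → A) {m m' : ℕ × ℕ → ℕ}
    (h : ∀ i j, i < j → j ≤ r → m (i, j) = m' (i, j)) : pbwMon f r m = pbwMon f r m' := by
  unfold pbwMon rowProd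
  refine congrArg List.prod (List.map_congr_left fun i _ => ?_)
  refine congrArg List.prod (List.map_congr_left fun j hj => ?_)
  rw [List.mem_range'_1] at hj
  simp only [h i j (by omega) (by omega)]

lemma FpowA_eq_pbwMon (p : RootA r → ℕ) :
    FpowA r k p = pbwMon (fgen r k) r fun q => pAtA r p q.1 q.2 := by
  unfold FpowA pbwMon rowProd
  refine congrArg List.prod (List.map_congr_left fun i _ => ?_)
  refine congrArg List.prod (List.map_congr_left fun j hj => ?_)
  rw [List.mem_range'_1] at hj
  rw [listBracket_reverse_range' (by omega)]

section Hom

variable {A B : Type*} [Ring A] [Ring B] (φ : A →+* B) (f : ℕ → A)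

lemma map_lieBr (a b : A) : φ (lieBr a b) = lieBr (φ a) (φ b) := by
  simp [lieBr]

lemma map_rootVec (i j : ℕ) : φ (rootVec f i j) = rootVec (fun u => φ (f u)) i j := by
  induction j with
  | zero => simp [rootVec]
  | succ j ih =>
    unfold rootVec at ih ⊢
    simp only
    split_ifs
    · rfl
    · rw [map_lieBr, ih]
    · exact map_zero φ

lemma map_pbwMon (r : ℕ) (m : ℕ × ℕ → ℕ) :
    φ (pbwMon f r m) = pbwMon (fun u => φ (f u)) r m := by
  simp only [pbwMon, rowProd, map_list_prod, List.map_map, Function.comp_def, map_pow,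
    map_rootVec]

end Hom

/-- The image of the generating polynomial of the weighted partitions of all variables. -/
lemma pbwMap_partSum {A : Type*} [Ring A] [Algebra (RF r k) A] (f : ℕ → A) :
    pbwMap (RF r k) f r (partSum (blockTerm (colV r k) (Xv r k) 0) univ) =
      ∑ P ∈ rootParts r k, (∏ B ∈ P, blockWt (colV r k) (Xv r k) 0 B) •
        pbwMon f r fun q => pAtA r (typeOf P) q.1 q.2 := by
  rw [partSum, map_sum, rootParts, sum_filter]
  refine sum_congr rfl fun P hP => ?_
  split_ifs with h
  · have hm : ∏ B ∈ P, blockTerm (colV r k) (Xv r k) 0 B =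
        MvPolynomial.monomial
          (∑ B ∈ P, Finsupp.single (blockLo (colV r k) B, blockHi (colV r k) B) 1)
          (∏ B ∈ P, blockWt (colV r k) (Xv r k) 0 B) := by
      rw [MvPolynomial.monomial_sum_prod]
      refine prod_congr rfl fun B _ => ?_
      rw [blockTerm, MvPolynomial.X, MvPolynomial.smul_monomial, smul_eq_mul, mul_one]
    rw [hm, pbwMap_monomial]
    congr 1
    refine pbwMon_congr f fun i j hij hj => ?_
    rw [pAtA, dif_pos ⟨by omega, by omega, hij⟩, typeOf, rootBlocks, card_filter,
      Finsupp.finsetSum_apply]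
    refine sum_congr rfl fun B hB => ?_
    rw [Finsupp.single_apply]
    refine if_congr ?_ rfl rfl
    constructor
    · intro hB'
      have := h B hB
      rw [Prod.mk.injEq] at hB'
      rw [IsRootBlock, hB'.1, hB'.2] at this
      exact this
    · intro hB'
      exact Prod.ext hB'.lo_eq hB'.hi_eq
  · push Not at h
    obtain ⟨B, hB, hB'⟩ := h
    have : blockTerm (colV r k) (Xv r k) 0 B = 0 := by
      rw [blockTerm, blockWt, if_neg hB', zero_smul]
    rw [prod_eq_zero hB this, map_zero]

/-- The right-hand side of the expansion as a sum over partitions. -/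
lemma finsum_omegaP_mul_FpowA :
    ∑ᶠ p : {p : RootA r → ℕ // ∀ u : Fin r, ∑ β : RootA r, p β * contA r β u = k u},
        algebraMap (RF r k) (FreeA r k) (omegaP r k p.val) * FpowA r k p.val =
      ∑ P ∈ rootParts r k, (∏ B ∈ P, blockWt (colV r k) (Xv r k) 0 B) •
        pbwMon (fgen r k) r fun q => pAtA r (typeOf P) q.1 q.2 := by
  have h : ∀ p : {p : RootA r → ℕ // ∀ u : Fin r, ∑ β : RootA r, p β * contA r β u = k u},
      algebraMap (RF r k) (FreeA r k) (omegaP r k p.val) * FpowA r k p.val =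
        ∑ P ∈ rootParts r k, if typeOf P = p.val then
          (∏ B ∈ P, blockWt (colV r k) (Xv r k) 0 B) •
            pbwMon (fgen r k) r fun q => pAtA r (typeOf P) q.1 q.2 else 0 := by
    rintro ⟨p, hp⟩
    rw [← Algebra.smul_def, omegaP_eq_sum hp, FpowA_eq_pbwMon, sum_smul, sum_filter]
    refine sum_congr rfl fun P _ => ?_
    split_ifs with hP
    · rw [hP]
    · rfl
  have hs : ∀ P ∈ rootParts r k,
      ∀ p : {p : RootA r → ℕ // ∀ u : Fin r, ∑ β : RootA r, p β * contA r β u = k u},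
      p.val ≠ typeOf P → (if typeOf P = p.val then
          (∏ B ∈ P, blockWt (colV r k) (Xv r k) 0 B) •
            pbwMon (fgen r k) r (fun q => pAtA r (typeOf P) q.1 q.2) else 0) = 0 :=
    fun P _ p hne => if_neg (Ne.symm hne)
  rw [finsum_congr h, finsum_sum_comm]
  · refine sum_congr rfl fun P hP => ?_
    rw [finsum_eq_single _ ⟨typeOf P, sum_typeOf_mul_contA hP⟩
      fun p hne => hs P hP p fun h => hne (Subtype.ext h), if_pos rfl]
  · intro P hP
    refine Set.Finite.subset (Set.finite_singleton ⟨typeOf P, sum_typeOf_mul_contA hP⟩) ?_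
    intro p hp
    by_contra hne
    exact hp (hs P hP p fun h => hne (Subtype.ext h))

/-- The Serre relations in the quotient algebra. -/
lemma serreRel_mk : SerreRel fun u =>
    RingCon.mkₐ (RF r k) (TwoSidedIdeal.span (serreA r k)).ringCon (fgen r k u) := by
  set φ := RingCon.mkₐ (RF r k) (TwoSidedIdeal.span (serreA r k)).ringCon
  have hφ : ∀ a b : FreeA r k, lieBr a b ∈ serreA r k → Commute (φ a) (φ b) := by
    intro a b h
    refine (RingCon.eq _).2 ((TwoSidedIdeal.rel_iff _ _ _).2 ?_)
    exact TwoSidedIdeal.subset_span h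
  have hz : ∀ a, ¬ a < r → φ (fgen r k a) = 0 := by
    intro a ha
    rw [fgen, dif_neg ha, map_zero]
  have hφl : ∀ a b : FreeA r k, lieBr (φ a) (φ b) = φ (lieBr a b) := fun a b => by
    simp [lieBr]
  refine ⟨fun a b hab => ?_, fun a => ?_, fun a => ?_⟩
  · by_cases hb : b < r
    · have ha : a < r := by omega
      simp only [fgen, dif_pos ha, dif_pos hb]
      exact hφ _ _ (Or.inl ⟨_, _, Or.inl hab, rfl⟩)
    · simp only [hz b hb, Commute.zero_right]
  · by_cases hb : a + 1 < r
    · have ha : a < r := by omega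
      simp only [fgen, dif_pos ha, dif_pos hb, hφl]
      exact hφ _ _ (Or.inr ⟨_, _, Or.inl rfl, rfl⟩)
    · simp [hz _ hb, lieBr]
  · by_cases hb : a + 1 < r
    · have ha : a < r := by omega
      simp only [fgen, dif_pos ha, dif_pos hb, hφl]
      exact hφ _ _ (Or.inr ⟨_, _, Or.inr rfl, rfl⟩)
    · simp [hz _ hb]

lemma Xv_injective : Function.Injective (Xv r k) :=
  (IsFractionRing.injective _ _).comp (MvPolynomial.X_injective)

lemma Xv_ne_zero (v : SVars r k) : Xv r k v ≠ 0 := by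
  rw [Xv, Ne, FaithfulSMul.algebraMap_eq_zero_iff]
  exact MvPolynomial.X_ne_zero v

lemma isAddTorsionFree_of_algebra (K A : Type*) [Field K] [CharZero K] [Ring A] [Algebra K A] :
    IsAddTorsionFree A := by
  refine ⟨fun n hn a b h => ?_⟩
  have h' : (n : K) • a = (n : K) • b := by
    rw [Nat.cast_smul_eq_nsmul, Nat.cast_smul_eq_nsmul]
    exact h
  exact (IsUnit.mk0 (n : K) (Nat.cast_ne_zero.2 hn)).smul_left_cancel.1 h'

end Expansion

/-- Poincaré–Birkhoff–Witt expansion of the canonical form, type `A_r`: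
for every `k ∈ ℕ^r`, modulo the two-sided ideal generated by the Serre relations,
`Σ_J ω_J · f_{J(|k|)} ⋯ f_{J(1)} = Σ_p ω_p · F^p`,
where `J` ranges over the multi-indices of content `k` and `p` over the maps
`{positive roots} → ℕ` with `Σ_β p_β·c(β) = k`. -/
theorem pbw_expansion_A (r : ℕ) (hr : 1 ≤ r) (k : Fin r → ℕ) :
    (∑ J ∈ univ.filter (fun J : Fin (∑ i, k i) → Fin r => IsContent r J k),
        algebraMap (RF r k) (FreeA r k) (omegaRF r k J) * monJ r k J) -
      (∑ᶠ p : {p : RootA r → ℕ // ∀ u : Fin r, ∑ β : RootA r, p β * contA r β u = k u},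
        algebraMap (RF r k) (FreeA r k) (omegaP r k p.val) * FpowA r k p.val) ∈
    TwoSidedIdeal.span (serreA r k) := by
  rw [sum_omegaRF_mul_monJ, finsum_omegaP_mul_FpowA, ← TwoSidedIdeal.rel_iff, ← RingCon.eq]
  let φ := RingCon.mkₐ (RF r k) (TwoSidedIdeal.span (serreA r k)).ringCon
  have := isAddTorsionFree_of_algebra (RF r k)
    (TwoSidedIdeal.span (serreA r k)).ringCon.Quotient
  change φ _ = φ _
  rw [map_chainSum φ, serreRel_mk.chainSum_eq (col := colV r k) (fun v => v.1.2) Xv_injective _ _ _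
    (by simp [Fintype.card_sigma]) (fun v _ => Xv_ne_zero v), pbwMap_partSum, map_sum]
  refine sum_congr rfl fun P _ => ?_
  rw [map_smul]
  exact congrArg _ (map_pbwMon φ.toRingHom (fgen r k) r _).symm

end
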